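/- arXiv:2602.11993 — 6 statements merged into one kernel-verified Lean document; each statement's English description precedes it below -/
import Mathlib

section
/- For every ε ≥ 0 there exists a finite connected graph G (which can be taken to be an induced subgraph of the square lattice on ℤ², with unit vertex weights) such that the BUD walk on B^ε_2(G) is not irreducible: B^ε_2(G) contains two trees that are not connected by any sequence of BUD steps within B^ε_2(G). -/
open SimpleGraph

/-- The total weight of a connected component of a graph. -/
noncomputable def compWeight {V : Type*} (G : SimpleGraph V) (p : V → ℝ)
    (c : G.ConnectedComponent) : ℝ :=
  ∑ᶠ v ∈ c.supp, p v

/-- `S` is a set of `k - 1` edges of `T` whose removal partitions the vertex set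
into `k` connected components, each of total weight within `ε/2` of `p(G)/k`. -/
def IsBalancedCutSet {V : Type*} (T : SimpleGraph V) (p : V → ℝ) (k : ℕ) (ε : ℝ)
    (S : Finset (Sym2 V)) : Prop :=
  (S : Set (Sym2 V)) ⊆ T.edgeSet ∧ S.card = k - 1 ∧
    Nat.card (T.deleteEdges (S : Set (Sym2 V))).ConnectedComponent = k ∧
    ∀ c : (T.deleteEdges (S : Set (Sym2 V))).ConnectedComponent,
      compWeight _ p c ∈
        Set.Icc ((∑ᶠ v, p v) / k - ε / 2) ((∑ᶠ v, p v) / k + ε / 2)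

/-- `T ∈ B^ε_k(G)`: `T` is an `ε`-balanced `k`-splittable spanning tree of `G`. -/
def MemB {V : Type*} (G : SimpleGraph V) (p : V → ℝ) (k : ℕ) (ε : ℝ)
    (T : SimpleGraph V) : Prop :=
  T ≤ G ∧ T.IsTree ∧ ∃ S : Finset (Sym2 V), IsBalancedCutSet T p k ε S

/-- A step of the BUD walk on `B^ε_k(G)`: add an edge `e` of `G` not in `T`,
then remove an edge `f` of the resulting unique cycle (equivalently, an edge
whose removal leaves a tree), such that the result is again in `B^ε_k(G)`. -/
def BUDStep {V : Type*} (G : SimpleGraph V) (p : V → ℝ) (k : ℕ) (ε : ℝ)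
    (T T' : SimpleGraph V) : Prop :=
  MemB G p k ε T ∧ MemB G p k ε T' ∧
  ∃ e ∈ G.edgeSet \ T.edgeSet, ∃ f ∈ (T ⊔ SimpleGraph.fromEdgeSet {e}).edgeSet,
    T' = (T ⊔ SimpleGraph.fromEdgeSet {e}).deleteEdges {f}

/-- The square lattice graph on `ℤ × ℤ`: points at Euclidean distance 1 are adjacent. -/
def latticeGraph : SimpleGraph (ℤ × ℤ) :=
  SimpleGraph.fromRel (fun u v => (u.1 - v.1) ^ 2 + (u.2 - v.2) ^ 2 = 1)


lemma closed_reach {V : Type*} {H : SimpleGraph V} {X : Set V}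
    (hcl : ∀ p q, H.Adj p q → (p ∈ X ↔ q ∈ X)) {p q : V} (h : H.Reachable p q) :
    p ∈ X ↔ q ∈ X := by
  obtain ⟨w⟩ := h
  induction w with
  | nil => exact Iff.rfl
  | cons h _ ih => exact (hcl _ _ h).trans ih

def parG {V : Type*} (r : V) (par : V → V) : SimpleGraph V :=
  SimpleGraph.fromRel (fun v w => v ≠ r ∧ par v = w)

lemma parG_adj {V : Type*} {r : V} {par : V → V} {d : V → ℤ}
    (hd : ∀ v, v ≠ r → d (par v) < d v) {v : V} (hv : v ≠ r) : (parG r par).Adj v (par v) := by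
  rw [parG, SimpleGraph.fromRel_adj]
  refine ⟨fun h => ?_, Or.inl ⟨hv, rfl⟩⟩
  have := hd v hv
  rw [← h] at this
  exact lt_irrefl _ this

lemma parG_edges {V : Type*} (r : V) (par : V → V) :
    (parG r par).edgeSet ⊆ (fun v => s(v, par v)) '' {v | v ≠ r} := by
  intro e
  induction e using Sym2.ind with
  | _ p q =>
    rw [SimpleGraph.mem_edgeSet, parG, SimpleGraph.fromRel_adj]
    rintro ⟨-, ⟨h, h'⟩ | ⟨h, h'⟩⟩
    · exact ⟨p, h, by simp [h']⟩
    · exact ⟨q, h, by simp [h', Sym2.eq_swap]⟩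

lemma parG_tree {V : Type*} [Finite V] {r : V} {par : V → V} {d : V → ℤ}
    (h0 : ∀ v, 0 ≤ d v)
    (hd : ∀ v, v ≠ r → d (par v) < d v) : (parG r par).IsTree := by
  have key : ∀ n : ℕ, ∀ v, d v ≤ n → (parG r par).Reachable v r := by
    intro n
    induction n with
    | zero =>
      intro v hv
      by_cases h : v = r
      · subst h; rfl
      · have := hd v h
        have := h0 (par v)
        push_cast at hv
        omega
    | succ n ih =>
      intro v hv
      by_cases h : v = r
      · subst h; rfl
      · have := hd v h
        push_cast at hv
        exact (parG_adj hd h).reachable.trans (ih _ (by omega))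
  have hr : ∀ v, (parG r par).Reachable v r := fun v => key (d v).toNat v (by omega)
  have hc : (parG r par).Connected := by
    have : Nonempty V := ⟨r⟩
    exact ⟨fun a b => (hr a).trans (hr b).symm⟩
  rw [SimpleGraph.isTree_iff_connected_and_card]
  refine ⟨hc, le_antisymm ?_ hc.card_vert_le_card_edgeSet_add_one⟩
  have h1 : Nat.card (parG r par).edgeSet ≤ ({v | v ≠ r} : Set V).ncard := by
    rw [Nat.card_coe_set_eq]
    exact (Set.ncard_le_ncard (parG_edges r par) (Set.toFinite _)).trans
      (Set.ncard_image_le (Set.toFinite _))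
  have h2 : ({v | v ≠ r} : Set V).ncard + 1 = Nat.card V := by
    have : ({v | v ≠ r} : Set V) = ({r} : Set V)ᶜ := by ext; simp
    rw [this, ← Set.ncard_add_ncard_compl ({r} : Set V), Set.ncard_singleton, add_comm]
  omega

lemma compWeight_one {V : Type*} [Finite V] (G : SimpleGraph V) (c : G.ConnectedComponent) :
    compWeight G (fun _ => (1 : ℝ)) c = (c.supp.ncard : ℝ) := by
  rw [compWeight, finsum_mem_eq_finite_toFinset_sum _ (Set.toFinite _)]
  simp [Set.ncard_eq_toFinset_card _ (Set.toFinite c.supp)]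

lemma total_one (V : Type*) [Finite V] : (∑ᶠ _v : V, (1 : ℝ)) = (Nat.card V : ℝ) := by
  have := Fintype.ofFinite V
  rw [finsum_eq_sum_of_fintype]
  simp

lemma parG_memB {V : Type*} [Finite V] {r w : V} {par : V → V} {d : V → ℤ} {X : Set V}
    {G : SimpleGraph V} {ε : ℝ} (hε : 0 ≤ ε)
    (h0 : ∀ v, 0 ≤ d v)
    (hd : ∀ v, v ≠ r → d (par v) < d v)
    (hG : ∀ v, v ≠ r → G.Adj v (par v))
    (hr : r ∉ X) (hw : w ∈ X) (hpw : par w ∉ X)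
    (hX : ∀ v, v ≠ r → v ≠ w → (v ∈ X ↔ par v ∈ X))
    (hcard : 2 * X.ncard = Nat.card V) :
    MemB G (fun _ => (1 : ℝ)) 2 ε (parG r par) := by
  have hwr : w ≠ r := fun h => hr (h ▸ hw)
  refine ⟨?_, parG_tree h0 hd, {s(w, par w)}, ?_, by simp, ?_⟩
  · intro a b hab
    rw [parG, SimpleGraph.fromRel_adj] at hab
    rcases hab with ⟨-, ⟨h, rfl⟩ | ⟨h, rfl⟩⟩
    · exact hG _ h
    · exact (hG _ h).symm
  · simpa using parG_adj hd hwr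
  rw [Finset.coe_singleton]
  set H := (parG r par).deleteEdges {s(w, par w)} with hH
  have hadj : ∀ v, v ≠ r → v ≠ w → H.Adj v (par v) := by
    intro v h1 h2
    rw [hH, SimpleGraph.deleteEdges_adj]
    refine ⟨parG_adj hd h1, ?_⟩
    rw [Set.mem_singleton_iff, Sym2.eq_iff]
    rintro (⟨h, -⟩ | ⟨h, h'⟩)
    · exact h2 h
    · have a := hd v h1
      have b := hd w hwr
      rw [h'] at a
      rw [← h] at b
      omega
  have hcl : ∀ p q, H.Adj p q → (p ∈ X ↔ q ∈ X) := by
    intro p q hpq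
    rw [hH, SimpleGraph.deleteEdges_adj, parG, SimpleGraph.fromRel_adj] at hpq
    obtain ⟨⟨-, ⟨h, rfl⟩ | ⟨h, rfl⟩⟩, h3⟩ := hpq
    · exact hX _ h (fun h => h3 (by simp [h]))
    · exact (hX _ h (fun h => h3 (by simp [h, Sym2.eq_swap]))).symm
  have key : ∀ n : ℕ, ∀ v, d v ≤ n → H.Reachable v (open Classical in if v ∈ X then w else r) := by
    intro n
    induction n with
    | zero =>
      intro v hv
      by_cases h : v = r
      · subst h; rw [if_neg hr]
      · have := hd v h
        have := h0 (par v)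
        push_cast at hv
        omega
    | succ n ih =>
      intro v hv
      by_cases h : v = r
      · subst h; rw [if_neg hr]
      by_cases h' : v = w
      · subst h'; rw [if_pos hw]
      · have := hd v h
        push_cast at hv
        have h5 := ih (par v) (by omega)
        refine (hadj v h h').reachable.trans ?_
        by_cases h6 : v ∈ X
        · rw [if_pos h6]
          rwa [if_pos ((hX v h h').1 h6)] at h5
        · rw [if_neg h6]
          rwa [if_neg (fun h7 => h6 ((hX v h h').2 h7))] at h5
  have k1 : ∀ v, v ∈ X → H.Reachable v w := fun v hv => by
    have := key (d v).toNat v (by omega)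
    rwa [if_pos hv] at this
  have k2 : ∀ v, v ∉ X → H.Reachable v r := fun v hv => by
    have := key (d v).toNat v (by omega)
    rwa [if_neg hv] at this
  have hne : H.connectedComponentMk w ≠ H.connectedComponentMk r := by
    intro h
    exact hr ((closed_reach hcl (SimpleGraph.ConnectedComponent.eq.1 h)).1 hw)
  have hall : ∀ c : H.ConnectedComponent,
      c = H.connectedComponentMk w ∨ c = H.connectedComponentMk r := by
    intro c
    induction c using SimpleGraph.ConnectedComponent.ind with
    | _ v =>
      by_cases h : v ∈ X
      · exact Or.inl (SimpleGraph.ConnectedComponent.eq.2 (k1 v h))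
      · exact Or.inr (SimpleGraph.ConnectedComponent.eq.2 (k2 v h))
  refine ⟨?_, ?_⟩
  · rw [Nat.card_eq_two_iff]
    refine ⟨_, _, hne, ?_⟩
    ext c
    simpa using hall c
  · have s1 : (H.connectedComponentMk w).supp = X := by
      ext v
      rw [SimpleGraph.ConnectedComponent.mem_supp_iff, SimpleGraph.ConnectedComponent.eq]
      exact ⟨fun h => (closed_reach hcl h).2 hw, k1 v⟩
    have s2 : (H.connectedComponentMk r).supp = Xᶜ := by
      ext v
      rw [SimpleGraph.ConnectedComponent.mem_supp_iff, SimpleGraph.ConnectedComponent.eq]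
      exact ⟨fun h h' => hr ((closed_reach hcl h).1 h'), k2 v⟩
    have h6 := Set.ncard_add_ncard_compl X
    have h7 : (Xᶜ.ncard : ℝ) = X.ncard := by
      have : Xᶜ.ncard = X.ncard := by omega
      rw [this]
    have h8 : (2 : ℝ) * X.ncard = Nat.card V := by exact_mod_cast hcard
    intro c
    rw [compWeight_one, total_one]
    push_cast
    rcases hall c with rfl | rfl
    · rw [s1]; constructor <;> linarith
    · rw [s2, h7]; constructor <;> linarith


def SS (L : ℤ) : Set (ℤ × ℤ) :=
  {p | (p.2 = 0 ∧ -(3 * L + 11) ≤ p.1 ∧ p.1 ≤ L + 2) ∨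
       (p.2 = 2 ∧ -L ≤ p.1 ∧ p.1 ≤ L + 4) ∨
       (p.2 = -2 ∧ -(2 * L + 2) ≤ p.1 ∧ p.1 ≤ L + 4) ∨
       (p.1 = 0 ∧ -2 ≤ p.2 ∧ p.2 ≤ 2) ∨
       (p.1 = 2 ∧ 0 ≤ p.2 ∧ p.2 ≤ L + 2) ∨
       (p.1 = L + 4 ∧ -2 ≤ p.2 ∧ p.2 ≤ 2)}

lemma mem_SS {L x y : ℤ} : (x, y) ∈ SS L ↔ 
       ((y = 0 ∧ -(3 * L + 11) ≤ x ∧ x ≤ L + 2) ∨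
       (y = 2 ∧ -L ≤ x ∧ x ≤ L + 4) ∨
       (y = -2 ∧ -(2 * L + 2) ≤ x ∧ x ≤ L + 4) ∨
       (x = 0 ∧ -2 ≤ y ∧ y ≤ 2) ∨
       (x = 2 ∧ 0 ≤ y ∧ y ≤ L + 2) ∨
       (x = L + 4 ∧ -2 ≤ y ∧ y ≤ 2)) := Iff.rfl

lemma SS_finite {L : ℤ} (hL : 40 ≤ L) : (SS L).Finite := by
  apply (Set.finite_Icc ((-(3 * L + 11), -2) : ℤ × ℤ) (L + 4, L + 2)).subset
  rintro ⟨x, y⟩ h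
  rw [mem_SS] at h
  rw [Set.mem_Icc, Prod.mk_le_mk, Prod.mk_le_mk]
  omega

lemma lat_adj {a b c d : ℤ} : latticeGraph.Adj (a, b) (c, d) ↔
    (a = c ∧ (d = b + 1 ∨ b = d + 1)) ∨ (b = d ∧ (c = a + 1 ∨ a = c + 1)) := by
  rw [latticeGraph, SimpleGraph.fromRel_adj]
  constructor
  · rintro ⟨-, h⟩
    have h : (a - c) ^ 2 + (b - d) ^ 2 = 1 := by
      rcases h with h | h
      · exact h
      · rw [← h]; ring
    have h1 : a - c ≤ 1 := by nlinarith [sq_nonneg (b - d)]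
    have h2 : -1 ≤ a - c := by nlinarith [sq_nonneg (b - d)]
    have h3 : b - d ≤ 1 := by nlinarith [sq_nonneg (a - c)]
    have h4 : -1 ≤ b - d := by nlinarith [sq_nonneg (a - c)]
    generalize hs : a - c = s at *
    generalize ht : b - d = t at *
    interval_cases s <;> interval_cases t <;> omega
  · intro h
    constructor
    · intro h'
      rw [Prod.mk.injEq] at h'
      omega
    · left
      rcases h with ⟨rfl, rfl | rfl⟩ | ⟨rfl, rfl | rfl⟩ <;> ring

noncomputable def BF (L : ℤ) : Fin 11 → Finset (ℤ × ℤ) :=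
  ![Finset.Icc (-(3 * L + 11)) 0 ×ˢ Finset.Icc 0 0,
    Finset.Icc 2 2 ×ˢ Finset.Icc 2 (L + 2),
    Finset.Icc 2 (L + 2) ×ˢ Finset.Icc 0 0,
    Finset.Icc (-(2 * L + 2)) 0 ×ˢ Finset.Icc (-2) (-2),
    Finset.Icc (-L) 0 ×ˢ Finset.Icc 2 2,
    (Finset.Icc 1 (L + 4) ×ˢ Finset.Icc (-2) (-2) ∪ Finset.Icc (L + 4) (L + 4) ×ˢ Finset.Icc (-1) 1) ∪
      Finset.Icc 3 (L + 4) ×ˢ Finset.Icc 2 2,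
    {(1, 0)}, {(2, 1)}, {(1, 2)}, {(0, 1)}, {(0, -1)}]

def BP (L x y : ℤ) : Fin 11 → Prop :=
  ![y = 0 ∧ -(3 * L + 11) ≤ x ∧ x ≤ 0,
    x = 2 ∧ 2 ≤ y ∧ y ≤ L + 2,
    y = 0 ∧ 2 ≤ x ∧ x ≤ L + 2,
    y = -2 ∧ -(2 * L + 2) ≤ x ∧ x ≤ 0,
    y = 2 ∧ -L ≤ x ∧ x ≤ 0,
    (y = -2 ∧ 1 ≤ x ∧ x ≤ L + 4) ∨ (x = L + 4 ∧ -1 ≤ y ∧ y ≤ 1) ∨ (y = 2 ∧ 3 ≤ x ∧ x ≤ L + 4),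
    x = 1 ∧ y = 0, x = 2 ∧ y = 1, x = 1 ∧ y = 2, x = 0 ∧ y = 1, x = 0 ∧ y = -1]

def wt (L : ℤ) : Fin 11 → ℤ :=
  ![3 * L + 12, L + 1, L + 1, 2 * L + 3, L + 1, 2 * L + 9, 1, 1, 1, 1, 1]

lemma mem_BF {L x y : ℤ} (i : Fin 11) : (x, y) ∈ BF L i ↔ BP L x y i := by
  fin_cases i <;> simp [BF, BP] <;> omega

lemma BF_card {L : ℤ} (hL : 40 ≤ L) (i : Fin 11) : ((BF L i).card : ℤ) = wt L i := by
  fin_cases i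
  · simp [BF, wt]; omega
  · simp [BF, wt]; omega
  · simp [BF, wt]; omega
  · simp [BF, wt]; omega
  · simp [BF, wt]; omega
  · simp only [BF, wt]
    show ((_ ∪ _ ∪ _ : Finset (ℤ × ℤ)).card : ℤ) = 2 * L + 9
    rw [Finset.card_union_of_disjoint, Finset.card_union_of_disjoint]
    · simp; omega
    · rw [Finset.disjoint_left]
      rintro ⟨x, y⟩ h h'
      simp only [Finset.mem_product, Finset.mem_Icc] at h h'
      omega
    · rw [Finset.disjoint_left]
      rintro ⟨x, y⟩ h h'
      simp only [Finset.mem_product, Finset.mem_Icc, Finset.mem_union] at h h'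
      omega
  all_goals rfl

lemma BP_SS {L x y : ℤ} (hL : 40 ≤ L) (i : Fin 11) (h : BP L x y i) : (x, y) ∈ SS L := by
  rw [mem_SS]
  fin_cases i <;> simp [BP] at h <;> omega

lemma SS_BP {L x y : ℤ} (hL : 40 ≤ L) (h : (x, y) ∈ SS L) : ∃ i, BP L x y i := by
  by_contra hc
  rw [not_exists] at hc
  have h0 := hc 0
  have h1 := hc 1
  have h2 := hc 2
  have h3 := hc 3
  have h4 := hc 4
  have h5 := hc 5
  have h6 := hc 6
  have h7 := hc 7
  have h8 := hc 8
  have h9 := hc 9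
  have h10 := hc 10
  simp [BP] at h0 h1 h2 h3 h4 h5 h6 h7 h8 h9 h10
  rw [mem_SS] at h
  rcases h with h | h | h | h | h | h <;> omega

lemma BP_or {L x y : ℤ} (i : Fin 11) (h : BP L x y i) :
    (i.val = 0 ∧ y = 0 ∧ -(3 * L + 11) ≤ x ∧ x ≤ 0) ∨
    (i.val = 1 ∧ x = 2 ∧ 2 ≤ y ∧ y ≤ L + 2) ∨
    (i.val = 2 ∧ y = 0 ∧ 2 ≤ x ∧ x ≤ L + 2) ∨
    (i.val = 3 ∧ y = -2 ∧ -(2 * L + 2) ≤ x ∧ x ≤ 0) ∨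
    (i.val = 4 ∧ y = 2 ∧ -L ≤ x ∧ x ≤ 0) ∨
    (i.val = 5 ∧ ((y = -2 ∧ 1 ≤ x ∧ x ≤ L + 4) ∨ (x = L + 4 ∧ -1 ≤ y ∧ y ≤ 1) ∨ (y = 2 ∧ 3 ≤ x ∧ x ≤ L + 4))) ∨
    (i.val = 6 ∧ x = 1 ∧ y = 0) ∨
    (i.val = 7 ∧ x = 2 ∧ y = 1) ∨
    (i.val = 8 ∧ x = 1 ∧ y = 2) ∨
    (i.val = 9 ∧ x = 0 ∧ y = 1) ∨
    (i.val = 10 ∧ x = 0 ∧ y = -1) := by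
  fin_cases i <;> simp [BP] at h <;> simp [h]

lemma BP_disj {L x y : ℤ} (hL : 40 ≤ L) (i j : Fin 11) (h : BP L x y i) (h' : BP L x y j) :
    i = j := by
  have a := BP_or i h
  have b := BP_or j h'
  apply Fin.ext
  rcases a with a | a | a | a | a | a | a | a | a | a | a <;> omega

lemma count {L : ℤ} (hL : 40 ≤ L) (Z : Set (SS L)) : ∃ k : Fin 11 → ℤ,
    (Z.ncard : ℤ) = k 0 + k 1 + k 2 + k 3 + k 4 + k 5 + k 6 + k 7 + k 8 + k 9 + k 10 ∧
    ∀ i, 0 ≤ k i ∧ k i ≤ wt L i ∧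
      ((∀ p : SS L, BP L p.1.1 p.1.2 i → p ∈ Z) → k i = wt L i) ∧
      ((∀ p : SS L, BP L p.1.1 p.1.2 i → p ∉ Z) → k i = 0) := by
  classical
  refine ⟨fun i => (((BF L i).filter (fun p => p ∈ Subtype.val '' Z)).card : ℤ), ?_,
    fun i => ⟨by positivity, ?_, ?_, ?_⟩⟩
  · have h1 : Z.ncard = (Finset.univ.biUnion
        (fun i => (BF L i).filter (fun p => p ∈ Subtype.val '' Z))).card := by
      rw [← Set.ncard_image_of_injective _ Subtype.val_injective, ← Set.ncard_coe_finset]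
      congr 1
      ext ⟨x, y⟩
      simp only [Finset.mem_coe, Finset.mem_biUnion, Finset.mem_univ, true_and, Finset.mem_filter,
        mem_BF, exists_and_right]
      refine ⟨fun h => ⟨?_, h⟩, fun h => h.2⟩
      obtain ⟨⟨p, hp⟩, -, rfl⟩ := h
      exact SS_BP hL hp
    rw [h1, Finset.card_biUnion]
    · push_cast
      simp only [Fin.sum_univ_succ]
      simp
      try ring_nf
      try rfl
    · intro i _ j _ hij
      change Disjoint _ _
      rw [Finset.disjoint_left]
      rintro ⟨x, y⟩ h h'
      rw [Finset.mem_filter, mem_BF] at h h'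
      exact hij (BP_disj hL i j h.1 h'.1)
  · rw [← BF_card hL i]
    exact Int.ofNat_le.2 (Finset.card_filter_le _ _)
  · intro h
    rw [← BF_card hL i]
    dsimp only
    rw [Finset.filter_true_of_mem]
    rintro ⟨x, y⟩ hp
    rw [mem_BF] at hp
    exact ⟨⟨(x, y), BP_SS hL i hp⟩, h _ hp, rfl⟩
  · intro h
    dsimp only
    rw [Finset.filter_false_of_mem]
    · simp
    · rintro ⟨x, y⟩ hp ⟨p, hp', hpp⟩
      rw [mem_BF] at hp
      refine h p ?_ hp'
      rw [hpp]
      exact hp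

lemma SS_card {L : ℤ} (hL : 40 ≤ L) : (Nat.card (SS L) : ℤ) = 10 * L + 32 := by
  obtain ⟨k, h, hk⟩ := count hL Set.univ
  have h2 : ∀ i, k i = wt L i := fun i => (hk i).2.2.1 (by simp)
  simp only [h2] at h
  rw [Set.ncard_univ] at h
  rw [h]
  simp [wt]
  ring


lemma reg {L x y : ℤ} (hL : 40 ≤ L) (hp : (x, y) ∈ SS L) :
    (y = 0 ∧ -(3 * L + 11) ≤ x ∧ x < 0) ∨
    (y = 0 ∧ 0 ≤ x ∧ x ≤ L + 2) ∨
    (y = -2 ∧ -(2 * L + 2) ≤ x ∧ x < 0) ∨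
    (y = -2 ∧ x = 0) ∨
    (y = -1 ∧ x = 0) ∨
    (y = -2 ∧ 1 ≤ x ∧ x < L + 4) ∨
    (x = L + 4 ∧ -2 ≤ y ∧ y < 2) ∨
    (y = 2 ∧ -L ≤ x ∧ x < 0) ∨
    (y = 2 ∧ x = 0) ∨
    (y = 2 ∧ x = 1) ∨
    (y = 2 ∧ 2 < x ∧ x ≤ L + 4) ∨
    (x = 2 ∧ 0 < y ∧ y ≤ L + 2) ∨
    (x = 0 ∧ y = 1) := by
  rw [mem_SS] at hp
  by_contra hc
  simp only [not_or] at hc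
  rcases hp with h | h | h | h | h | h <;> omega

def RA (L x y x' y' v : ℤ) : Prop :=
    ((y = 0 ∧ -(3 * L + 11) ≤ x ∧ x < 0) ∧ x' = x + 1 ∧ y' = y ∧ v = -x) ∨
    ((y = 0 ∧ 0 ≤ x ∧ x ≤ L + 2) ∧ x' = x - 1 ∧ y' = y ∧ v = x) ∨
    ((y = -2 ∧ -(2 * L + 2) ≤ x ∧ x < 0) ∧ x' = x + 1 ∧ y' = y ∧ v = 2 - x) ∨
    ((y = -2 ∧ x = 0) ∧ x' = 0 ∧ y' = -1 ∧ v = 2) ∨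
    ((y = -1 ∧ x = 0) ∧ x' = 0 ∧ y' = 0 ∧ v = 1) ∨
    ((y = -2 ∧ 1 ≤ x ∧ x < L + 4) ∧ x' = x + 1 ∧ y' = y ∧ v = 2 * L + 14 - x) ∨
    ((x = L + 4 ∧ -2 ≤ y ∧ y < 2) ∧ x' = x ∧ y' = y + 1 ∧ v = L + 8 - y) ∨
    ((y = 2 ∧ -L ≤ x ∧ x < 0) ∧ x' = x + 1 ∧ y' = y ∧ v = 6 - x) ∨
    ((y = 2 ∧ x = 0) ∧ x' = x + 1 ∧ y' = y ∧ v = 6) ∨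
    ((y = 2 ∧ x = 1) ∧ x' = x + 1 ∧ y' = y ∧ v = 5) ∨
    ((y = 2 ∧ 2 < x ∧ x ≤ L + 4) ∧ x' = x - 1 ∧ y' = y ∧ v = x + 2) ∨
    ((x = 2 ∧ 0 < y ∧ y ≤ L + 2) ∧ x' = x ∧ y' = y - 1 ∧ v = y + 2) ∨
    ((x = 0 ∧ y = 1) ∧ x' = 0 ∧ y' = 2 ∧ v = 7)

lemma exA {L : ℤ} (hL : 40 ≤ L) (p : SS L) :
    ∃ q : SS L × ℤ, RA L p.1.1 p.1.2 q.1.1.1 q.1.1.2 q.2 := by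
  obtain ⟨⟨x, y⟩, hp⟩ := p
  rcases reg hL hp with h | h | h | h | h | h | h | h | h | h | h | h | h
  · exact ⟨(⟨(x + 1, y), by rw [mem_SS]; omega⟩, -x), Or.inl ⟨h, rfl, rfl, rfl⟩⟩
  · exact ⟨(⟨(x - 1, y), by rw [mem_SS]; omega⟩, x), Or.inr (Or.inl ⟨h, rfl, rfl, rfl⟩)⟩
  · exact ⟨(⟨(x + 1, y), by rw [mem_SS]; omega⟩, 2 - x), Or.inr (Or.inr (Or.inl ⟨h, rfl, rfl, rfl⟩))⟩
  · exact ⟨(⟨(0, -1), by rw [mem_SS]; omega⟩, 2), Or.inr (Or.inr (Or.inr (Or.inl ⟨h, rfl, rfl, rfl⟩)))⟩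
  · exact ⟨(⟨(0, 0), by rw [mem_SS]; omega⟩, 1), Or.inr (Or.inr (Or.inr (Or.inr (Or.inl ⟨h, rfl, rfl, rfl⟩))))⟩
  · exact ⟨(⟨(x + 1, y), by rw [mem_SS]; omega⟩, 2 * L + 14 - x), Or.inr (Or.inr (Or.inr (Or.inr (Or.inr (Or.inl ⟨h, rfl, rfl, rfl⟩)))))⟩
  · exact ⟨(⟨(x, y + 1), by rw [mem_SS]; omega⟩, L + 8 - y), Or.inr (Or.inr (Or.inr (Or.inr (Or.inr (Or.inr (Or.inl ⟨h, rfl, rfl, rfl⟩))))))⟩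
  · exact ⟨(⟨(x + 1, y), by rw [mem_SS]; omega⟩, 6 - x), Or.inr (Or.inr (Or.inr (Or.inr (Or.inr (Or.inr (Or.inr (Or.inl ⟨h, rfl, rfl, rfl⟩)))))))⟩
  · exact ⟨(⟨(x + 1, y), by rw [mem_SS]; omega⟩, 6), Or.inr (Or.inr (Or.inr (Or.inr (Or.inr (Or.inr (Or.inr (Or.inr (Or.inl ⟨h, rfl, rfl, rfl⟩))))))))⟩
  · exact ⟨(⟨(x + 1, y), by rw [mem_SS]; omega⟩, 5), Or.inr (Or.inr (Or.inr (Or.inr (Or.inr (Or.inr (Or.inr (Or.inr (Or.inr (Or.inl ⟨h, rfl, rfl, rfl⟩)))))))))⟩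
  · exact ⟨(⟨(x - 1, y), by rw [mem_SS]; omega⟩, x + 2), Or.inr (Or.inr (Or.inr (Or.inr (Or.inr (Or.inr (Or.inr (Or.inr (Or.inr (Or.inr (Or.inl ⟨h, rfl, rfl, rfl⟩))))))))))⟩
  · exact ⟨(⟨(x, y - 1), by rw [mem_SS]; omega⟩, y + 2), Or.inr (Or.inr (Or.inr (Or.inr (Or.inr (Or.inr (Or.inr (Or.inr (Or.inr (Or.inr (Or.inr (Or.inl ⟨h, rfl, rfl, rfl⟩)))))))))))⟩
  · exact ⟨(⟨(0, 2), by rw [mem_SS]; omega⟩, 7), Or.inr (Or.inr (Or.inr (Or.inr (Or.inr (Or.inr (Or.inr (Or.inr (Or.inr (Or.inr (Or.inr (Or.inr (⟨h, rfl, rfl, rfl⟩))))))))))))⟩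

noncomputable def parA {L : ℤ} (hL : 40 ≤ L) (p : SS L) : SS L := (Classical.choose (exA hL p)).1

noncomputable def dA {L : ℤ} (hL : 40 ≤ L) (p : SS L) : ℤ := (Classical.choose (exA hL p)).2

lemma relA {L : ℤ} (hL : 40 ≤ L) (p : SS L) :
    RA L p.1.1 p.1.2 (parA hL p).1.1 (parA hL p).1.2 (dA hL p) :=
  Classical.choose_spec (exA hL p)

lemma RA_adj {L x y x' y' v : ℤ} (hL : 40 ≤ L) (h : RA L x y x' y' v) :
    latticeGraph.Adj (x, y) (x', y') ∧ 0 ≤ v := by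
  rw [lat_adj]
  rcases h with h | h | h | h | h | h | h | h | h | h | h | h | h <;> omega

lemma RA_lt {L x y x' y' x'' y'' v v' : ℤ} (hL : 40 ≤ L) (h : RA L x y x' y' v)
    (h' : RA L x' y' x'' y'' v') (h0 : ¬ (x = 0 ∧ y = 0)) : v' < v := by
  rcases h with h | h | h | h | h | h | h | h | h | h | h | h | h <;>
    rcases h' with h' | h' | h' | h' | h' | h' | h' | h' | h' | h' | h' | h' | h' <;> omega

def RB (L x y x' y' v : ℤ) : Prop :=
    ((y = 0 ∧ -(3 * L + 11) ≤ x ∧ x < 0) ∧ x' = x + 1 ∧ y' = y ∧ v = -x) ∨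
    ((y = 0 ∧ 0 ≤ x ∧ x ≤ L + 2) ∧ x' = x - 1 ∧ y' = y ∧ v = x) ∨
    ((y = -2 ∧ -(2 * L + 2) ≤ x ∧ x < 0) ∧ x' = x + 1 ∧ y' = y ∧ v = 2 * L + 14 - x) ∨
    ((y = -2 ∧ x = 0) ∧ x' = x + 1 ∧ y' = y ∧ v = 2 * L + 14 - x) ∨
    ((y = -1 ∧ x = 0) ∧ x' = 0 ∧ y' = -2 ∧ v = 2 * L + 15) ∨
    ((y = -2 ∧ 1 ≤ x ∧ x < L + 4) ∧ x' = x + 1 ∧ y' = y ∧ v = 2 * L + 14 - x) ∨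
    ((x = L + 4 ∧ -2 ≤ y ∧ y < 2) ∧ x' = x ∧ y' = y + 1 ∧ v = L + 8 - y) ∨
    ((y = 2 ∧ -L ≤ x ∧ x < 0) ∧ x' = x + 1 ∧ y' = y ∧ v = 2 - x) ∨
    ((y = 2 ∧ x = 0) ∧ x' = 0 ∧ y' = 1 ∧ v = 2) ∨
    ((y = 2 ∧ x = 1) ∧ x' = x + 1 ∧ y' = y ∧ v = 5) ∨
    ((y = 2 ∧ 2 < x ∧ x ≤ L + 4) ∧ x' = x - 1 ∧ y' = y ∧ v = x + 2) ∨
    ((x = 2 ∧ 0 < y ∧ y ≤ L + 2) ∧ x' = x ∧ y' = y - 1 ∧ v = y + 2) ∨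
    ((x = 0 ∧ y = 1) ∧ x' = 0 ∧ y' = 0 ∧ v = 1)

lemma exB {L : ℤ} (hL : 40 ≤ L) (p : SS L) :
    ∃ q : SS L × ℤ, RB L p.1.1 p.1.2 q.1.1.1 q.1.1.2 q.2 := by
  obtain ⟨⟨x, y⟩, hp⟩ := p
  rcases reg hL hp with h | h | h | h | h | h | h | h | h | h | h | h | h
  · exact ⟨(⟨(x + 1, y), by rw [mem_SS]; omega⟩, -x), Or.inl ⟨h, rfl, rfl, rfl⟩⟩
  · exact ⟨(⟨(x - 1, y), by rw [mem_SS]; omega⟩, x), Or.inr (Or.inl ⟨h, rfl, rfl, rfl⟩)⟩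
  · exact ⟨(⟨(x + 1, y), by rw [mem_SS]; omega⟩, 2 * L + 14 - x), Or.inr (Or.inr (Or.inl ⟨h, rfl, rfl, rfl⟩))⟩
  · exact ⟨(⟨(x + 1, y), by rw [mem_SS]; omega⟩, 2 * L + 14 - x), Or.inr (Or.inr (Or.inr (Or.inl ⟨h, rfl, rfl, rfl⟩)))⟩
  · exact ⟨(⟨(0, -2), by rw [mem_SS]; omega⟩, 2 * L + 15), Or.inr (Or.inr (Or.inr (Or.inr (Or.inl ⟨h, rfl, rfl, rfl⟩))))⟩
  · exact ⟨(⟨(x + 1, y), by rw [mem_SS]; omega⟩, 2 * L + 14 - x), Or.inr (Or.inr (Or.inr (Or.inr (Or.inr (Or.inl ⟨h, rfl, rfl, rfl⟩)))))⟩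
  · exact ⟨(⟨(x, y + 1), by rw [mem_SS]; omega⟩, L + 8 - y), Or.inr (Or.inr (Or.inr (Or.inr (Or.inr (Or.inr (Or.inl ⟨h, rfl, rfl, rfl⟩))))))⟩
  · exact ⟨(⟨(x + 1, y), by rw [mem_SS]; omega⟩, 2 - x), Or.inr (Or.inr (Or.inr (Or.inr (Or.inr (Or.inr (Or.inr (Or.inl ⟨h, rfl, rfl, rfl⟩)))))))⟩
  · exact ⟨(⟨(0, 1), by rw [mem_SS]; omega⟩, 2), Or.inr (Or.inr (Or.inr (Or.inr (Or.inr (Or.inr (Or.inr (Or.inr (Or.inl ⟨h, rfl, rfl, rfl⟩))))))))⟩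
  · exact ⟨(⟨(x + 1, y), by rw [mem_SS]; omega⟩, 5), Or.inr (Or.inr (Or.inr (Or.inr (Or.inr (Or.inr (Or.inr (Or.inr (Or.inr (Or.inl ⟨h, rfl, rfl, rfl⟩)))))))))⟩
  · exact ⟨(⟨(x - 1, y), by rw [mem_SS]; omega⟩, x + 2), Or.inr (Or.inr (Or.inr (Or.inr (Or.inr (Or.inr (Or.inr (Or.inr (Or.inr (Or.inr (Or.inl ⟨h, rfl, rfl, rfl⟩))))))))))⟩
  · exact ⟨(⟨(x, y - 1), by rw [mem_SS]; omega⟩, y + 2), Or.inr (Or.inr (Or.inr (Or.inr (Or.inr (Or.inr (Or.inr (Or.inr (Or.inr (Or.inr (Or.inr (Or.inl ⟨h, rfl, rfl, rfl⟩)))))))))))⟩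
  · exact ⟨(⟨(0, 0), by rw [mem_SS]; omega⟩, 1), Or.inr (Or.inr (Or.inr (Or.inr (Or.inr (Or.inr (Or.inr (Or.inr (Or.inr (Or.inr (Or.inr (Or.inr (⟨h, rfl, rfl, rfl⟩))))))))))))⟩

noncomputable def parB {L : ℤ} (hL : 40 ≤ L) (p : SS L) : SS L := (Classical.choose (exB hL p)).1

noncomputable def dB {L : ℤ} (hL : 40 ≤ L) (p : SS L) : ℤ := (Classical.choose (exB hL p)).2

lemma relB {L : ℤ} (hL : 40 ≤ L) (p : SS L) :
    RB L p.1.1 p.1.2 (parB hL p).1.1 (parB hL p).1.2 (dB hL p) :=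
  Classical.choose_spec (exB hL p)

lemma RB_adj {L x y x' y' v : ℤ} (hL : 40 ≤ L) (h : RB L x y x' y' v) :
    latticeGraph.Adj (x, y) (x', y') ∧ 0 ≤ v := by
  rw [lat_adj]
  rcases h with h | h | h | h | h | h | h | h | h | h | h | h | h <;> omega

lemma RB_lt {L x y x' y' x'' y'' v v' : ℤ} (hL : 40 ≤ L) (h : RB L x y x' y' v)
    (h' : RB L x' y' x'' y'' v') (h0 : ¬ (x = 0 ∧ y = 0)) : v' < v := by
  rcases h with h | h | h | h | h | h | h | h | h | h | h | h | h <;>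
    rcases h' with h' | h' | h' | h' | h' | h' | h' | h' | h' | h' | h' | h' | h' <;> omega


def vv {L : ℤ} (x y : ℤ) (h : (x, y) ∈ SS L) : SS L := ⟨(x, y), h⟩

lemma vv_ext {L : ℤ} (p : SS L) {x y : ℤ} (h : (x, y) ∈ SS L) :
    p = vv x y h ↔ p.1.1 = x ∧ p.1.2 = y := by
  rw [vv, Subtype.ext_iff, Prod.ext_iff]

lemma SS_ext {L : ℤ} (p q : SS L) : p = q ↔ p.1.1 = q.1.1 ∧ p.1.2 = q.1.2 := by
  rw [Subtype.ext_iff, Prod.ext_iff]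

lemma mem00 {L : ℤ} (hL : 40 ≤ L) : (0, 0) ∈ SS L := by rw [mem_SS]; omega
lemma mem01 {L : ℤ} (hL : 40 ≤ L) : (0, 1) ∈ SS L := by rw [mem_SS]; omega
lemma mem10 {L : ℤ} (hL : 40 ≤ L) : (1, 0) ∈ SS L := by rw [mem_SS]; omega
lemma mem21 {L : ℤ} (hL : 40 ≤ L) : (2, 1) ∈ SS L := by rw [mem_SS]; omega
lemma mem0m1 {L : ℤ} (hL : 40 ≤ L) : (0, -1) ∈ SS L := by rw [mem_SS]; omega
lemma mem0m2 {L : ℤ} (hL : 40 ≤ L) : (0, -2) ∈ SS L := by rw [mem_SS]; omega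
lemma mem1m2 {L : ℤ} (hL : 40 ≤ L) : (1, -2) ∈ SS L := by rw [mem_SS]; omega

noncomputable def TA {L : ℤ} (hL : 40 ≤ L) : SimpleGraph (SS L) := parG (vv 0 0 (mem00 hL)) (parA hL)
noncomputable def TB {L : ℤ} (hL : 40 ≤ L) : SimpleGraph (SS L) := parG (vv 0 0 (mem00 hL)) (parB hL)

abbrev GG (L : ℤ) : SimpleGraph (SS L) := latticeGraph.induce (SS L)

def XA (L : ℤ) : Set (SS L) :=
  {p | ¬ ((p.1.2 = 0 ∧ p.1.1 ≤ 0) ∨ (p.1.1 = 0 ∧ p.1.2 = -1) ∨ (p.1.2 = -2 ∧ p.1.1 ≤ 0))}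
def XB (L : ℤ) : Set (SS L) :=
  {p | ¬ ((p.1.2 = 0 ∧ p.1.1 ≤ L + 2) ∨ (p.1.1 = 0 ∧ p.1.2 = 1) ∨ (p.1.2 = 2 ∧ p.1.1 ≤ 0))}

lemma mem_XA {L : ℤ} (p : SS L) : p ∈ XA L ↔
  ¬ ((p.1.2 = 0 ∧ p.1.1 ≤ 0) ∨ (p.1.1 = 0 ∧ p.1.2 = -1) ∨ (p.1.2 = -2 ∧ p.1.1 ≤ 0)) := Iff.rfl
lemma mem_XB {L : ℤ} (p : SS L) : p ∈ XB L ↔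
  ¬ ((p.1.2 = 0 ∧ p.1.1 ≤ L + 2) ∨ (p.1.1 = 0 ∧ p.1.2 = 1) ∨ (p.1.2 = 2 ∧ p.1.1 ≤ 0)) := Iff.rfl

lemma XA_card {L : ℤ} (hL : 40 ≤ L) : 2 * (XA L).ncard = Nat.card (SS L) := by
  have h1 := SS_card hL
  obtain ⟨k, h, hk⟩ := count hL (XA L)
  have e0 := (hk 0).2.2.2 (by intro p; rw [mem_XA]; simp [BP]; omega)
  have e1 := (hk 1).2.2.1 (by intro p; rw [mem_XA]; simp [BP]; omega)
  have e2 := (hk 2).2.2.1 (by intro p; rw [mem_XA]; simp [BP]; omega)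
  have e3 := (hk 3).2.2.2 (by intro p; rw [mem_XA]; simp [BP]; omega)
  have e4 := (hk 4).2.2.1 (by intro p; rw [mem_XA]; simp [BP]; omega)
  have e5 := (hk 5).2.2.1 (by intro p; rw [mem_XA]; simp [BP]; omega)
  have e6 := (hk 6).2.2.1 (by intro p; rw [mem_XA]; simp [BP]; omega)
  have e7 := (hk 7).2.2.1 (by intro p; rw [mem_XA]; simp [BP]; omega)
  have e8 := (hk 8).2.2.1 (by intro p; rw [mem_XA]; simp [BP]; omega)
  have e9 := (hk 9).2.2.1 (by intro p; rw [mem_XA]; simp [BP]; omega)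
  have e10 := (hk 10).2.2.2 (by intro p; rw [mem_XA]; simp [BP]; omega)
  simp [wt] at e0 e1 e2 e3 e4 e5 e6 e7 e8 e9 e10
  omega

lemma XB_card {L : ℤ} (hL : 40 ≤ L) : 2 * (XB L).ncard = Nat.card (SS L) := by
  have h1 := SS_card hL
  obtain ⟨k, h, hk⟩ := count hL (XB L)
  have e0 := (hk 0).2.2.2 (by intro p; rw [mem_XB]; simp [BP]; omega)
  have e1 := (hk 1).2.2.1 (by intro p; rw [mem_XB]; simp [BP]; omega)
  have e2 := (hk 2).2.2.2 (by intro p; rw [mem_XB]; simp [BP]; omega)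
  have e3 := (hk 3).2.2.1 (by intro p; rw [mem_XB]; simp [BP]; omega)
  have e4 := (hk 4).2.2.2 (by intro p; rw [mem_XB]; simp [BP]; omega)
  have e5 := (hk 5).2.2.1 (by intro p; rw [mem_XB]; simp [BP]; omega)
  have e6 := (hk 6).2.2.2 (by intro p; rw [mem_XB]; simp [BP]; omega)
  have e7 := (hk 7).2.2.1 (by intro p; rw [mem_XB]; simp [BP]; omega)
  have e8 := (hk 8).2.2.1 (by intro p; rw [mem_XB]; simp [BP]; omega)
  have e9 := (hk 9).2.2.2 (by intro p; rw [mem_XB]; simp [BP]; omega)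
  have e10 := (hk 10).2.2.1 (by intro p; rw [mem_XB]; simp [BP]; omega)
  simp [wt] at e0 e1 e2 e3 e4 e5 e6 e7 e8 e9 e10
  omega

lemma TA_memB {L : ℤ} (hL : 40 ≤ L) {ε : ℝ} (hε : 0 ≤ ε) :
    MemB (GG L) (fun _ => (1 : ℝ)) 2 ε (TA hL) := by
  have : Finite (SS L) := SS_finite hL
  refine parG_memB (w := vv 1 0 (mem10 hL)) (d := dA hL) (X := XA L) hε ?_ ?_ ?_ ?_ ?_ ?_ ?_
    (XA_card hL)
  · exact fun v => (RA_adj hL (relA hL v)).2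
  · intro v hv
    rw [Ne, vv_ext] at hv
    exact RA_lt hL (relA hL v) (relA hL _) hv
  · exact fun v _ => (RA_adj hL (relA hL v)).1
  · rw [mem_XA]; simp [vv]
  · rw [mem_XA]; simp [vv]
  · rw [mem_XA]
    have h := relA hL (vv 1 0 (mem10 hL))
    simp [vv, RA] at h ⊢
    omega
  · intro v h1 h2
    rw [Ne, vv_ext] at h1 h2
    have h := relA hL v
    rw [mem_XA, mem_XA]
    rcases h with h | h | h | h | h | h | h | h | h | h | h | h | h <;> omega

lemma TB_memB {L : ℤ} (hL : 40 ≤ L) {ε : ℝ} (hε : 0 ≤ ε) :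
    MemB (GG L) (fun _ => (1 : ℝ)) 2 ε (TB hL) := by
  have : Finite (SS L) := SS_finite hL
  refine parG_memB (w := vv 2 1 (mem21 hL)) (d := dB hL) (X := XB L) hε ?_ ?_ ?_ ?_ ?_ ?_ ?_
    (XB_card hL)
  · exact fun v => (RB_adj hL (relB hL v)).2
  · intro v hv
    rw [Ne, vv_ext] at hv
    exact RB_lt hL (relB hL v) (relB hL _) hv
  · exact fun v _ => (RB_adj hL (relB hL v)).1
  · rw [mem_XB]; simp [vv]; omega
  · rw [mem_XB]; simp [vv]
  · rw [mem_XB]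
    have h := relB hL (vv 2 1 (mem21 hL))
    simp [vv, RB] at h ⊢
    omega
  · intro v h1 h2
    rw [Ne, vv_ext] at h1 h2
    have h := relB hL v
    rw [mem_XB, mem_XB]
    rcases h with h | h | h | h | h | h | h | h | h | h | h | h | h <;> omega

lemma GG_edge {L x y a b x' y' a' b' v w : ℤ} (hL : 40 ≤ L)
    (hp : RA L x y x' y' v) (hq : RA L a b a' b' w)
    (h : (x = a ∧ b = y + 1) ∨ (y = b ∧ a = x + 1)) :
    (¬ (x = 0 ∧ y = 0) ∧ x' = a ∧ y' = b) ∨ (¬ (a = 0 ∧ b = 0) ∧ a' = x ∧ b' = y) ∨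
    (x = 0 ∧ y = 0 ∧ a = 0 ∧ b = 1) ∨ (x = 0 ∧ y = -2 ∧ a = 1 ∧ b = -2) := by
  rcases h with ⟨rfl, rfl⟩ | ⟨rfl, rfl⟩
  · rcases hp with h | h | h | h | h | h | h | h | h | h | h | h | h <;>
      rcases hq with h' | h' | h' | h' | h' | h' | h' | h' | h' | h' | h' | h' | h' <;> omega
  · rcases hp with h | h | h | h | h | h | h | h | h | h | h | h | h <;>
      rcases hq with h' | h' | h' | h' | h' | h' | h' | h' | h' | h' | h' | h' | h' <;> omega

noncomputable def e1 {L : ℤ} (hL : 40 ≤ L) : Sym2 (SS L) := s(vv 0 0 (mem00 hL), vv 0 1 (mem01 hL))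
noncomputable def e2 {L : ℤ} (hL : 40 ≤ L) : Sym2 (SS L) := s(vv 0 (-2) (mem0m2 hL), vv 1 (-2) (mem1m2 hL))

lemma GG_adj {L : ℤ} {p q : SS L} : (GG L).Adj p q ↔
    (p.1.1 = q.1.1 ∧ (q.1.2 = p.1.2 + 1 ∨ p.1.2 = q.1.2 + 1)) ∨
    (p.1.2 = q.1.2 ∧ (q.1.1 = p.1.1 + 1 ∨ p.1.1 = q.1.1 + 1)) := by
  obtain ⟨⟨x, y⟩, hp⟩ := p
  obtain ⟨⟨a, b⟩, hq⟩ := q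
  exact lat_adj

lemma GG_edge' {L : ℤ} (hL : 40 ≤ L) {p q : SS L}
    (h : (p.1.1 = q.1.1 ∧ q.1.2 = p.1.2 + 1) ∨ (p.1.2 = q.1.2 ∧ q.1.1 = p.1.1 + 1)) :
    (TA hL).Adj p q ∨ s(p, q) = e1 hL ∨ s(p, q) = e2 hL := by
  have hne : p ≠ q := by
    rw [Ne, SS_ext]; omega
  rcases GG_edge hL (relA hL p) (relA hL q) h with h | h | h | h
  · left
    rw [TA, parG, SimpleGraph.fromRel_adj]
    refine ⟨hne, Or.inl ⟨?_, ?_⟩⟩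
    · rw [Ne, vv_ext]; exact h.1
    · rw [SS_ext]; exact h.2
  · left
    rw [TA, parG, SimpleGraph.fromRel_adj]
    refine ⟨hne, Or.inr ⟨?_, ?_⟩⟩
    · rw [Ne, vv_ext]; exact h.1
    · rw [SS_ext]; exact h.2
  · right; left
    rw [e1, Sym2.eq_iff, vv_ext, vv_ext, vv_ext, vv_ext]
    omega
  · right; right
    rw [e2, Sym2.eq_iff, vv_ext, vv_ext, vv_ext, vv_ext]
    omega

lemma not_TA {L : ℤ} (hL : 40 ≤ L) : e1 hL ∉ (TA hL).edgeSet ∧ e2 hL ∉ (TA hL).edgeSet := by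
  rw [e1, e2, SimpleGraph.mem_edgeSet, SimpleGraph.mem_edgeSet, TA, parG, SimpleGraph.fromRel_adj,
    SimpleGraph.fromRel_adj]
  have a := relA hL (vv 0 0 (mem00 hL))
  have b := relA hL (vv 0 1 (mem01 hL))
  have c := relA hL (vv 0 (-2) (mem0m2 hL))
  have d := relA hL (vv 1 (-2) (mem1m2 hL))
  simp only [RA] at a b c d
  simp [vv] at a b c d
  simp only [vv_ext, Ne]
  simp only [vv]
  omega

lemma not_TB {L : ℤ} (hL : 40 ≤ L) :
    s(vv 0 0 (mem00 hL), vv 0 (-1) (mem0m1 hL)) ∉ (TB hL).edgeSet := by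
  rw [SimpleGraph.mem_edgeSet, TB, parG, SimpleGraph.fromRel_adj]
  have a := relB hL (vv 0 0 (mem00 hL))
  have b := relB hL (vv 0 (-1) (mem0m1 hL))
  simp only [RB] at a b
  simp [vv] at a b
  simp only [vv_ext, Ne]
  simp only [vv]
  omega

lemma GG_edgeSet {L : ℤ} (hL : 40 ≤ L) :
    (GG L).edgeSet = (TA hL).edgeSet ∪ {e1 hL, e2 hL} := by
  apply Set.Subset.antisymm
  · intro e
    induction e using Sym2.ind with
    | _ p q =>
      intro h
      rw [SimpleGraph.mem_edgeSet, GG_adj] at h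
      simp only [Set.mem_union, Set.mem_insert_iff, Set.mem_singleton_iff, SimpleGraph.mem_edgeSet]
      by_cases h' : (p.1.1 = q.1.1 ∧ q.1.2 = p.1.2 + 1) ∨ (p.1.2 = q.1.2 ∧ q.1.1 = p.1.1 + 1)
      · exact GG_edge' hL h'
      · rw [SimpleGraph.adj_comm, Sym2.eq_swap]
        exact GG_edge' hL (by omega)
  · rw [Set.union_subset_iff]
    refine ⟨SimpleGraph.edgeSet_subset_edgeSet.2 (TA_memB hL le_rfl).1, ?_⟩
    rw [Set.insert_subset_iff, Set.singleton_subset_iff, e1, e2, SimpleGraph.mem_edgeSet,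
      SimpleGraph.mem_edgeSet, GG_adj, GG_adj]
    simp [vv]

lemma miss_card {L : ℤ} (hL : 40 ≤ L) {T : SimpleGraph (SS L)} (h1 : T ≤ GG L) (h2 : T.IsTree) :
    ((GG L).edgeSet \ T.edgeSet).ncard = 2 := by
  have : Finite (SS L) := SS_finite hL
  have a := (SimpleGraph.isTree_iff_connected_and_card.1 h2).2
  have b := (SimpleGraph.isTree_iff_connected_and_card.1 (TA_memB hL le_rfl).2.1).2
  have hne : e1 hL ≠ e2 hL := by
    rw [e1, e2, Ne, Sym2.eq_iff]
    simp [vv]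
  have c : (GG L).edgeSet.ncard = (TA hL).edgeSet.ncard + 2 := by
    rw [GG_edgeSet hL, Set.ncard_union_eq, Set.ncard_pair hne]
    rw [Set.disjoint_left]
    rintro e he (h | h)
    · exact (not_TA hL).1 (h ▸ he)
    · rw [Set.mem_singleton_iff] at h
      exact (not_TA hL).2 (h ▸ he)
  rw [Set.ncard_sdiff (SimpleGraph.edgeSet_subset_edgeSet.2 h1)]
  rw [Nat.card_coe_set_eq] at a b
  omega


def QL (L x y : ℤ) : Fin 11 → Prop :=
  ![y = 0 ∧ 0 ≤ x ∧ x ≤ 2,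
    (y = -2 ∧ 0 ≤ x) ∨ (x = L + 4) ∨ (y = 2 ∧ 2 ≤ x),
    x = 0 ∧ 0 ≤ y ∧ y ≤ 2,
    x = 2 ∧ 0 ≤ y ∧ y ≤ 2,
    x = 0 ∧ -2 ≤ y ∧ y ≤ 0,
    y = 2 ∧ 0 ≤ x ∧ x ≤ 2,
    y = 0 ∧ x ≤ 0,
    y = 0 ∧ 2 ≤ x,
    y = -2 ∧ x ≤ 0,
    y = 2 ∧ x ≤ 0,
    x = 2 ∧ 2 ≤ y]

lemma QL_or {L x y : ℤ} (i : Fin 11) (h : QL L x y i) :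
    (i.val = 0 ∧ y = 0 ∧ 0 ≤ x ∧ x ≤ 2) ∨
    (i.val = 1 ∧ ((y = -2 ∧ 0 ≤ x) ∨ (x = L + 4) ∨ (y = 2 ∧ 2 ≤ x))) ∨
    (i.val = 2 ∧ x = 0 ∧ 0 ≤ y ∧ y ≤ 2) ∨
    (i.val = 3 ∧ x = 2 ∧ 0 ≤ y ∧ y ≤ 2) ∨
    (i.val = 4 ∧ x = 0 ∧ -2 ≤ y ∧ y ≤ 0) ∨
    (i.val = 5 ∧ y = 2 ∧ 0 ≤ x ∧ x ≤ 2) ∨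
    (i.val = 6 ∧ y = 0 ∧ x ≤ 0) ∨
    (i.val = 7 ∧ y = 0 ∧ 2 ≤ x) ∨
    (i.val = 8 ∧ y = -2 ∧ x ≤ 0) ∨
    (i.val = 9 ∧ y = 2 ∧ x ≤ 0) ∨
    (i.val = 10 ∧ x = 2 ∧ 2 ≤ y) := by
  fin_cases i <;> simp [QL] at h <;> simp [h]

def IsLab (L : ℤ) (i : Fin 11) (e : Sym2 (SS L)) : Prop := ∀ p ∈ e, QL L p.1.1 p.1.2 i

lemma isLab_mk {L : ℤ} {i : Fin 11} {p q : SS L} :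
    IsLab L i s(p, q) ↔ QL L p.1.1 p.1.2 i ∧ QL L q.1.1 q.1.2 i := by
  simp [IsLab]

lemma lab_uniq_aux {L x y a b : ℤ} (hL : 40 ≤ L) (_hp : (x, y) ∈ SS L) (hq : (a, b) ∈ SS L)
    (h : (x = a ∧ b = y + 1) ∨ (y = b ∧ a = x + 1)) (i j : Fin 11)
    (hi : QL L x y i ∧ QL L a b i) (hj : QL L x y j ∧ QL L a b j) : i = j := by
  apply Fin.ext
  rw [mem_SS] at hq
  have h1 := QL_or i hi.1
  have h2 := QL_or i hi.2
  have h3 := QL_or j hj.1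
  have h4 := QL_or j hj.2
  clear hi hj
  rcases h with ⟨rfl, rfl⟩ | ⟨rfl, rfl⟩
  · rcases h1 with h1 | h1 | h1 | h1 | h1 | h1 | h1 | h1 | h1 | h1 | h1 <;>
      rcases h3 with h3 | h3 | h3 | h3 | h3 | h3 | h3 | h3 | h3 | h3 | h3 <;> omega
  · rcases h1 with h1 | h1 | h1 | h1 | h1 | h1 | h1 | h1 | h1 | h1 | h1 <;>
      rcases h3 with h3 | h3 | h3 | h3 | h3 | h3 | h3 | h3 | h3 | h3 | h3 <;> omega

lemma lab_uniq {L : ℤ} (hL : 40 ≤ L) {e : Sym2 (SS L)} (he : e ∈ (GG L).edgeSet) (i j : Fin 11)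
    (hi : IsLab L i e) (hj : IsLab L j e) : i = j := by
  induction e using Sym2.ind with
  | _ p q =>
    rw [isLab_mk] at hi hj
    rw [SimpleGraph.mem_edgeSet, GG_adj] at he
    by_cases h' : (p.1.1 = q.1.1 ∧ q.1.2 = p.1.2 + 1) ∨ (p.1.2 = q.1.2 ∧ q.1.1 = p.1.1 + 1)
    · exact lab_uniq_aux hL p.2 q.2 h' i j hi hj
    · have h2 : (q.1.1 = p.1.1 ∧ p.1.2 = q.1.2 + 1) ∨ (q.1.2 = p.1.2 ∧ p.1.1 = q.1.1 + 1) := by omega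
      exact lab_uniq_aux hL q.2 p.2 h2 i j hi.symm hj.symm

lemma lab_ex_aux {L x y a b : ℤ} (hL : 40 ≤ L) (hp : (x, y) ∈ SS L) (hq : (a, b) ∈ SS L)
    (h : (x = a ∧ b = y + 1) ∨ (y = b ∧ a = x + 1)) : ∃ i, QL L x y i ∧ QL L a b i := by
  rw [mem_SS] at hp hq
  rcases h with ⟨rfl, rfl⟩ | ⟨rfl, rfl⟩
  · have hc : (x = 0 ∧ 0 ≤ y ∧ y ≤ 1) ∨ (x = 0 ∧ -2 ≤ y ∧ y < 0) ∨ (x = 2 ∧ 0 ≤ y ∧ y ≤ 1) ∨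
        (x = 2 ∧ 2 ≤ y) ∨ x = L + 4 := by
      rcases hp with h | h | h | h | h | h <;> omega
    clear hp hq
    rcases hc with h | h | h | h | h
    · exact ⟨2, by simp [QL]; omega⟩
    · exact ⟨4, by simp [QL]; omega⟩
    · exact ⟨3, by simp [QL]; omega⟩
    · exact ⟨10, by simp [QL]; omega⟩
    · exact ⟨1, by simp [QL]; omega⟩
  · have hc : (y = 0 ∧ x < 0) ∨ (y = 0 ∧ 0 ≤ x ∧ x ≤ 1) ∨ (y = 0 ∧ 2 ≤ x) ∨
        (y = -2 ∧ x < 0) ∨ (y = -2 ∧ 0 ≤ x) ∨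
        (y = 2 ∧ x < 0) ∨ (y = 2 ∧ 0 ≤ x ∧ x ≤ 1) ∨ (y = 2 ∧ 2 ≤ x) := by
      rcases hp with h | h | h | h | h | h <;> omega
    clear hp hq
    rcases hc with h | h | h | h | h | h | h | h
    · exact ⟨6, by simp [QL]; omega⟩
    · exact ⟨0, by simp [QL]; omega⟩
    · exact ⟨7, by simp [QL]; omega⟩
    · exact ⟨8, by simp [QL]; omega⟩
    · exact ⟨1, by simp [QL]; omega⟩
    · exact ⟨9, by simp [QL]; omega⟩
    · exact ⟨5, by simp [QL]; omega⟩
    · exact ⟨1, by simp [QL]; omega⟩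

lemma lab_ex {L : ℤ} (hL : 40 ≤ L) {e : Sym2 (SS L)} (he : e ∈ (GG L).edgeSet) :
    ∃ i, IsLab L i e := by
  induction e using Sym2.ind with
  | _ p q =>
    rw [SimpleGraph.mem_edgeSet, GG_adj] at he
    by_cases h' : (p.1.1 = q.1.1 ∧ q.1.2 = p.1.2 + 1) ∨ (p.1.2 = q.1.2 ∧ q.1.1 = p.1.1 + 1)
    · obtain ⟨i, hi⟩ := lab_ex_aux hL p.2 q.2 h'
      exact ⟨i, isLab_mk.2 hi⟩
    · have h2 : (q.1.1 = p.1.1 ∧ p.1.2 = q.1.2 + 1) ∨ (q.1.2 = p.1.2 ∧ p.1.1 = q.1.1 + 1) := by omega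
      obtain ⟨i, hi⟩ := lab_ex_aux hL q.2 p.2 h2
      exact ⟨i, isLab_mk.2 hi.symm⟩

lemma ncard_le_block {L : ℤ} (hL : 40 ≤ L) (Y : Set (SS L)) (i : Fin 11)
    (h : ∀ p ∈ Y, BP L p.1.1 p.1.2 i) : (Y.ncard : ℤ) ≤ 3 * L + 12 := by
  obtain ⟨k, hs, hk⟩ := count hL Y
  have h0 : ∀ j, j ≠ i → k j = 0 := fun j hj =>
    (hk j).2.2.2 (fun p hp hpY => hj (BP_disj hL j i hp (h p hpY)))
  have h1 : (Y.ncard : ℤ) = k i := by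
    have : (Y.ncard : ℤ) = ∑ j, k j := by
      rw [hs]; simp only [Fin.sum_univ_succ]; simp; ring_nf; try rfl
    rw [this, Finset.sum_eq_single i (fun j _ hj => h0 j hj) (by simp)]
  rw [h1]
  refine (hk i).2.1.trans ?_
  fin_cases i <;> simp [wt] <;> omega

lemma pend_mk {L : ℤ} (hL : 40 ≤ L) (Y : Set (SS L)) (p q : SS L) (i : Fin 11)
    (hY : ∀ p ∈ Y, BP L p.1.1 p.1.2 i) (hp : p ∈ Y) (hq : q ∉ Y)
    (hcl : ∀ a b, (GG L).Adj a b → a ∈ Y → b ∉ Y → a = p ∧ b = q) :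
    ∃ (Y : Set (SS L)) (p0 q0 : SS L), s(p, q) = s(p0, q0) ∧ p0 ∈ Y ∧ q0 ∉ Y ∧
      (Y.ncard : ℤ) ≤ 3 * L + 12 ∧
      ∀ a b, (GG L).Adj a b → s(a, b) ≠ s(p, q) → (a ∈ Y ↔ b ∈ Y) := by
  refine ⟨Y, p, q, rfl, hp, hq, ncard_le_block hL Y i hY, fun a b hab hne => ?_⟩
  constructor
  · intro ha
    by_contra hb
    obtain ⟨rfl, rfl⟩ := hcl a b hab ha hb
    exact hne rfl
  · intro hb
    by_contra ha
    obtain ⟨rfl, rfl⟩ := hcl b a hab.symm hb ha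
    exact hne Sym2.eq_swap

lemma pend_aux {L : ℤ} (hL : 40 ≤ L) (p q : SS L)
    (h : (p.1.1 = q.1.1 ∧ q.1.2 = p.1.2 + 1) ∨ (p.1.2 = q.1.2 ∧ q.1.1 = p.1.1 + 1)) (i : Fin 11)
    (hi : 6 ≤ i.val) (hl : IsLab L i s(p, q)) :
    ∃ (Y : Set (SS L)) (p0 q0 : SS L), s(p, q) = s(p0, q0) ∧ p0 ∈ Y ∧ q0 ∉ Y ∧
      (Y.ncard : ℤ) ≤ 3 * L + 12 ∧
      ∀ a b, (GG L).Adj a b → s(a, b) ≠ s(p, q) → (a ∈ Y ↔ b ∈ Y) := by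
  obtain ⟨⟨x, y⟩, hp⟩ := p
  obtain ⟨⟨a, b⟩, hq⟩ := q
  rw [isLab_mk] at hl
  dsimp only at h hl
  have hc : (y = 0 ∧ x < 0 ∧ b = y ∧ a = x + 1) ∨
    (y = -2 ∧ x < 0 ∧ b = y ∧ a = x + 1) ∨
    (y = 2 ∧ x < 0 ∧ b = y ∧ a = x + 1) ∨
    (y = 0 ∧ 2 ≤ x ∧ b = y ∧ a = x + 1) ∨
    (x = 2 ∧ 2 ≤ y ∧ b = y + 1 ∧ a = x) := by
    have hi' : i = 6 ∨ i = 7 ∨ i = 8 ∨ i = 9 ∨ i = 10 := by omega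
    rcases hi' with rfl | rfl | rfl | rfl | rfl <;> simp [QL] at hl
    · left; omega
    · right; right; right; left; omega
    · right; left; omega
    · right; right; left; omega
    · right; right; right; right; omega
  clear h hl hi
  rcases hc with ⟨rfl, h, rfl, rfl⟩ | ⟨rfl, h, rfl, rfl⟩ | ⟨rfl, h, rfl, rfl⟩ | 
    ⟨rfl, h, rfl, rfl⟩ | ⟨rfl, h, rfl, rfl⟩
  · refine pend_mk hL {r | r.1.2 = 0 ∧ r.1.1 ≤ x} _ _ 0 ?_ ?_ ?_ ?_
    · rintro ⟨⟨c, d⟩, hr⟩ hm; rw [mem_SS] at hr; simp [BP] at hm ⊢; omega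
    · simp
    · simp
    · rintro ⟨⟨c, d⟩, hr⟩ ⟨⟨c', d'⟩, hr'⟩ hab h1 h2
      rw [GG_adj] at hab; rw [mem_SS] at hr hr'; rw [SS_ext, SS_ext]
      simp only [Set.mem_ofPred_eq] at *
      omega
  · refine pend_mk hL {r | r.1.2 = -2 ∧ r.1.1 ≤ x} _ _ 3 ?_ ?_ ?_ ?_
    · rintro ⟨⟨c, d⟩, hr⟩ hm; rw [mem_SS] at hr; simp [BP] at hm ⊢; omega
    · simp
    · simp
    · rintro ⟨⟨c, d⟩, hr⟩ ⟨⟨c', d'⟩, hr'⟩ hab h1 h2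
      rw [GG_adj] at hab; rw [mem_SS] at hr hr'; rw [SS_ext, SS_ext]
      simp only [Set.mem_ofPred_eq] at *
      omega
  · refine pend_mk hL {r | r.1.2 = 2 ∧ r.1.1 ≤ x} _ _ 4 ?_ ?_ ?_ ?_
    · rintro ⟨⟨c, d⟩, hr⟩ hm; rw [mem_SS] at hr; simp [BP] at hm ⊢; omega
    · simp
    · simp
    · rintro ⟨⟨c, d⟩, hr⟩ ⟨⟨c', d'⟩, hr'⟩ hab h1 h2
      rw [GG_adj] at hab; rw [mem_SS] at hr hr'; rw [SS_ext, SS_ext]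
      simp only [Set.mem_ofPred_eq] at *
      omega
  · rw [Sym2.eq_swap]
    refine pend_mk hL {r | r.1.2 = 0 ∧ x + 1 ≤ r.1.1 ∧ r.1.1 ≤ L + 2} _ _ 2 ?_ ?_ ?_ ?_
    · rintro ⟨⟨c, d⟩, hr⟩ hm; rw [mem_SS] at hr; simp [BP] at hm ⊢; omega
    · have hp' := hp; have hq' := hq; rw [mem_SS] at hp' hq'; simp; omega
    · simp
    · rintro ⟨⟨c, d⟩, hr⟩ ⟨⟨c', d'⟩, hr'⟩ hab h1 h2
      rw [GG_adj] at hab; rw [mem_SS] at hr hr'; rw [SS_ext, SS_ext]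
      simp only [Set.mem_ofPred_eq] at *
      omega
  · rw [Sym2.eq_swap]
    refine pend_mk hL {r | r.1.1 = 2 ∧ y + 1 ≤ r.1.2} _ _ 1 ?_ ?_ ?_ ?_
    · rintro ⟨⟨c, d⟩, hr⟩ hm; rw [mem_SS] at hr; simp [BP] at hm ⊢; omega
    · simp
    · simp
    · rintro ⟨⟨c, d⟩, hr⟩ ⟨⟨c', d'⟩, hr'⟩ hab h1 h2
      rw [GG_adj] at hab; rw [mem_SS] at hr hr'; rw [SS_ext, SS_ext]
      simp only [Set.mem_ofPred_eq] at *
      omega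

lemma pend {L : ℤ} (hL : 40 ≤ L) {e : Sym2 (SS L)} (he : e ∈ (GG L).edgeSet) (i : Fin 11)
    (hi : 6 ≤ i.val) (hl : IsLab L i e) :
    ∃ (Y : Set (SS L)) (p0 q0 : SS L), e = s(p0, q0) ∧ p0 ∈ Y ∧ q0 ∉ Y ∧
      (Y.ncard : ℤ) ≤ 3 * L + 12 ∧
      ∀ a b, (GG L).Adj a b → s(a, b) ≠ e → (a ∈ Y ↔ b ∈ Y) := by
  induction e using Sym2.ind with
  | _ p q =>
    rw [SimpleGraph.mem_edgeSet, GG_adj] at he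
    by_cases h' : (p.1.1 = q.1.1 ∧ q.1.2 = p.1.2 + 1) ∨ (p.1.2 = q.1.2 ∧ q.1.1 = p.1.1 + 1)
    · exact pend_aux hL p q h' i hi hl
    · rw [Sym2.eq_swap] at hl ⊢
      exact pend_aux hL q p (by omega) i hi hl

lemma int_const (f : ℤ → Prop) (a b : ℤ) (h : ∀ x, a ≤ x → x < b → (f x ↔ f (x + 1))) :
    ∀ x, a ≤ x → x ≤ b → (f x ↔ f a) := by
  intro x hx
  induction x, hx using Int.leInduction with
  | base => intro _; rfl
  | succ n hn ih =>
    intro hb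
    rw [← h n hn (by omega)]
    exact ih (by omega)

def PX {L : ℤ} (X : Set (SS L)) (x y : ℤ) : Prop := ∃ h : (x, y) ∈ SS L, (⟨(x, y), h⟩ : SS L) ∈ X

lemma mem_PX {L : ℤ} (X : Set (SS L)) (p : SS L) : p ∈ X ↔ PX X p.1.1 p.1.2 := by
  constructor
  · intro h; exact ⟨p.2, h⟩
  · rintro ⟨_, h⟩; exact h

lemma PX_step {L : ℤ} {X : Set (SS L)} {R : Set (Sym2 (SS L))}
    (hcl : ∀ a b, (GG L).Adj a b → s(a, b) ∉ R → (a ∈ X ↔ b ∈ X)) {i : Fin 11}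
    (hR : ∀ e ∈ R, ¬ IsLab L i e) {x y a b : ℤ} (hp : (x, y) ∈ SS L) (hq : (a, b) ∈ SS L)
    (h1 : QL L x y i) (h2 : QL L a b i)
    (h : (x = a ∧ (b = y + 1 ∨ y = b + 1)) ∨ (y = b ∧ (a = x + 1 ∨ x = a + 1))) :
    PX X x y ↔ PX X a b := by
  have := hcl ⟨(x, y), hp⟩ ⟨(a, b), hq⟩ (lat_adj.2 h) (fun hm => hR _ hm (isLab_mk.2 ⟨h1, h2⟩))
  rw [mem_PX, mem_PX] at this
  exact this

lemma PX_row {L : ℤ} {X : Set (SS L)} {R : Set (Sym2 (SS L))}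
    (hcl : ∀ a b, (GG L).Adj a b → s(a, b) ∉ R → (a ∈ X ↔ b ∈ X)) {i : Fin 11}
    (hR : ∀ e ∈ R, ¬ IsLab L i e) (y a b : ℤ) (hS : ∀ x, a ≤ x → x ≤ b → (x, y) ∈ SS L)
    (hQ : ∀ x, a ≤ x → x ≤ b → QL L x y i) :
    ∀ x, a ≤ x → x ≤ b → (PX X x y ↔ PX X a y) :=
  int_const (fun x => PX X x y) a b (fun x h1 h2 =>
    PX_step hcl hR (hS x h1 (by omega)) (hS (x + 1) (by omega) (by omega))
      (hQ x h1 (by omega)) (hQ (x + 1) (by omega) (by omega)) (by omega))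

lemma PX_col {L : ℤ} {X : Set (SS L)} {R : Set (Sym2 (SS L))}
    (hcl : ∀ a b, (GG L).Adj a b → s(a, b) ∉ R → (a ∈ X ↔ b ∈ X)) {i : Fin 11}
    (hR : ∀ e ∈ R, ¬ IsLab L i e) (x a b : ℤ) (hS : ∀ y, a ≤ y → y ≤ b → (x, y) ∈ SS L)
    (hQ : ∀ y, a ≤ y → y ≤ b → QL L x y i) :
    ∀ y, a ≤ y → y ≤ b → (PX X x y ↔ PX X x a) :=
  int_const (fun y => PX X x y) a b (fun x h1 h2 =>
    PX_step hcl hR (hS x h1 (by omega)) (hS (x + 1) (by omega) (by omega))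
      (hQ x h1 (by omega)) (hQ (x + 1) (by omega) (by omega)) (by omega))

lemma arith (L la lb lf u v a b c k0 k1 k2 k3 k4 k5 k6 k7 k8 k9 k10 : ℤ) (hL : 40 ≤ L)
    (hla : la = 0 ∨ la = 1 ∨ la = 2) (hlb : lb = 3 ∨ lb = 4 ∨ lb = 5)
    (hlf : lf = 0 ∨ lf = 1 ∨ lf = 2 ∨ lf = 3 ∨ lf = 4 ∨ lf = 5)
    (H0 : la ≠ 0 → lf ≠ 0 → u = a)
    (H1 : la ≠ 1 → lf ≠ 1 → b = v ∧ ((v = 0 ∧ k5 = 0) ∨ (v = 1 ∧ k5 = 2 * L + 9)))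
    (H2 : la ≠ 2 → lf ≠ 2 → u = c)
    (H3 : lb ≠ 3 → lf ≠ 3 → a = v)
    (H4 : lb ≠ 4 → lf ≠ 4 → u = b)
    (H5 : lb ≠ 5 → lf ≠ 5 → c = v)
    (K0 : (u = 0 ∧ k0 = 0) ∨ (u = 1 ∧ k0 = 3 * L + 12))
    (K1 : (v = 0 ∧ k1 = 0) ∨ (v = 1 ∧ k1 = L + 1))
    (K2 : (a = 0 ∧ k2 = 0) ∨ (a = 1 ∧ k2 = L + 1))
    (K3 : (b = 0 ∧ k3 = 0) ∨ (b = 1 ∧ k3 = 2 * L + 3))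
    (K4 : (c = 0 ∧ k4 = 0) ∨ (c = 1 ∧ k4 = L + 1))
    (B5 : 0 ≤ k5 ∧ k5 ≤ 2 * L + 9) (B6 : 0 ≤ k6 ∧ k6 ≤ 1) (B7 : 0 ≤ k7 ∧ k7 ≤ 1)
    (B8 : 0 ≤ k8 ∧ k8 ≤ 1) (B9 : 0 ≤ k9 ∧ k9 ≤ 1) (B10 : 0 ≤ k10 ∧ k10 ≤ 1)
    (hlo : 9 * L + 32 ≤ 2 * (k0 + k1 + k2 + k3 + k4 + k5 + k6 + k7 + k8 + k9 + k10))
    (hhi : 2 * (k0 + k1 + k2 + k3 + k4 + k5 + k6 + k7 + k8 + k9 + k10) ≤ 11 * L + 32) : False := by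
  obtain ⟨r, hr, hr0, hr5⟩ : ∃ r, r = k6 + k7 + k8 + k9 + k10 ∧ 0 ≤ r ∧ r ≤ 5 :=
    ⟨_, rfl, by omega, by omega⟩
  have hlo' : 9 * L + 32 ≤ 2 * (k0 + k1 + k2 + k3 + k4 + k5 + r) := by omega
  have hhi' : 2 * (k0 + k1 + k2 + k3 + k4 + k5 + r) ≤ 11 * L + 32 := by omega
  clear hlo hhi hr B6 B7 B8 B9 B10
  rcases hla with rfl | rfl | rfl <;> rcases hlb with rfl | rfl | rfl <;>
    rcases hlf with rfl | rfl | rfl | rfl | rfl | rfl <;>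
    norm_num at H0 H1 H2 H3 H4 H5 <;> subst_vars <;> omega

lemma kval {L : ℤ} {X : Set (SS L)} {j : Fin 11} {kj : ℤ}
    (h1 : (∀ p : SS L, BP L p.1.1 p.1.2 j → p ∈ X) → kj = wt L j)
    (h2 : (∀ p : SS L, BP L p.1.1 p.1.2 j → p ∉ X) → kj = 0) (W : Prop) (u : ℤ)
    (hu : (W ∧ u = 1) ∨ (¬ W ∧ u = 0))
    (hc : ∀ x y, BP L x y j → (PX X x y ↔ W)) : (u = 0 ∧ kj = 0) ∨ (u = 1 ∧ kj = wt L j) := by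
  rcases hu with ⟨hW, hu⟩ | ⟨hW, hu⟩
  · right
    exact ⟨hu, h1 (fun p hp => (mem_PX X p).2 ((hc _ _ hp).2 hW))⟩
  · left
    exact ⟨hu, h2 (fun p hp hpX => hW ((hc _ _ hp).1 ((mem_PX X p).1 hpX)))⟩

lemma ind_ex (W : Prop) : ∃ u : ℤ, (W ∧ u = 1) ∨ (¬ W ∧ u = 0) := by
  by_cases h : W
  · exact ⟨1, Or.inl ⟨h, rfl⟩⟩
  · exact ⟨0, Or.inr ⟨h, rfl⟩⟩

lemma ind_eq {W W' : Prop} {u u' : ℤ} (h : (W ∧ u = 1) ∨ (¬ W ∧ u = 0))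
    (h' : (W' ∧ u' = 1) ∨ (¬ W' ∧ u' = 0)) (hw : W ↔ W') : u = u' := by
  rcases h with ⟨a, b⟩ | ⟨a, b⟩ <;> rcases h' with ⟨c, d⟩ | ⟨c, d⟩
  · omega
  · exact absurd (hw.1 a) c
  · exact absurd (hw.2 c) a
  · omega

lemma core {L : ℤ} (hL : 40 ≤ L) {X : Set (SS L)} {R : Set (Sym2 (SS L))}
    (hcl : ∀ a b, (GG L).Adj a b → s(a, b) ∉ R → (a ∈ X ↔ b ∈ X)) (la lb lf : Fin 11)
    (hla : la.val ≤ 2) (hlb : 3 ≤ lb.val ∧ lb.val ≤ 5) (hlf : lf.val ≤ 5)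
    (hR : ∀ i, i ≠ la → i ≠ lb → i ≠ lf → ∀ e ∈ R, ¬ IsLab L i e)
    (hlo : 9 * L + 32 ≤ 2 * (X.ncard : ℤ)) (hhi : 2 * (X.ncard : ℤ) ≤ 11 * L + 32) : False := by
  obtain ⟨k, hs, hk⟩ := count hL X
  obtain ⟨u, hu⟩ := ind_ex (PX X 0 0)
  obtain ⟨v, hv⟩ := ind_ex (PX X 2 2)
  obtain ⟨a, ha⟩ := ind_ex (PX X 2 0)
  obtain ⟨b, hb⟩ := ind_ex (PX X 0 (-2))
  obtain ⟨c, hc⟩ := ind_ex (PX X 0 2)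
  have R6 := hR 6 (by omega) (by omega) (by omega)
  have R7 := hR 7 (by omega) (by omega) (by omega)
  have R8 := hR 8 (by omega) (by omega) (by omega)
  have R9 := hR 9 (by omega) (by omega) (by omega)
  have R10 := hR 10 (by omega) (by omega) (by omega)
  have hw : wt L 0 = 3 * L + 12 ∧ wt L 1 = L + 1 ∧ wt L 2 = L + 1 ∧ wt L 3 = 2 * L + 3 ∧
    wt L 4 = L + 1 ∧ wt L 5 = 2 * L + 9 ∧ wt L 6 = 1 ∧ wt L 7 = 1 ∧ wt L 8 = 1 ∧ wt L 9 = 1 ∧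
    wt L 10 = 1 := ⟨rfl, rfl, rfl, rfl, rfl, rfl, rfl, rfl, rfl, rfl, rfl⟩
  obtain ⟨w0, w1, w2, w3, w4, w5, w6, w7, w8, w9, w10⟩ := hw
  have q6 := PX_row hcl R6 0 (-(3 * L + 11)) 0 (by intros; rw [mem_SS]; omega)
    (by intros; simp [QL]; omega)
  have q7 := PX_row hcl R7 0 2 (L + 2) (by intros; rw [mem_SS]; omega)
    (by intros; simp [QL]; omega)
  have q8 := PX_row hcl R8 (-2) (-(2 * L + 2)) 0 (by intros; rw [mem_SS]; omega)
    (by intros; simp [QL]; omega)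
  have q9 := PX_row hcl R9 2 (-L) 0 (by intros; rw [mem_SS]; omega)
    (by intros; simp [QL]; omega)
  have q10 := PX_col hcl R10 2 2 (L + 2) (by intros; rw [mem_SS]; omega)
    (by intros; simp [QL]; omega)
  have K0 := kval (hk 0).2.2.1 (hk 0).2.2.2 _ u hu (by
    intro x y h
    have h := BP_or 0 h
    have h : y = 0 ∧ -(3 * L + 11) ≤ x ∧ x ≤ 0 := by simpa using h
    rw [h.1, q6 x h.2.1 h.2.2, q6 0 (by omega) (by omega)])
  have K1 := kval (hk 1).2.2.1 (hk 1).2.2.2 _ v hv (by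
    intro x y h
    have h := BP_or 1 h
    have h : x = 2 ∧ 2 ≤ y ∧ y ≤ L + 2 := by simpa using h
    rw [h.1, q10 y h.2.1 h.2.2])
  have K2 := kval (hk 2).2.2.1 (hk 2).2.2.2 _ a ha (by
    intro x y h
    have h := BP_or 2 h
    have h : y = 0 ∧ 2 ≤ x ∧ x ≤ L + 2 := by simpa using h
    rw [h.1, q7 x h.2.1 h.2.2])
  have K3 := kval (hk 3).2.2.1 (hk 3).2.2.2 _ b hb (by
    intro x y h
    have h := BP_or 3 h
    have h : y = -2 ∧ -(2 * L + 2) ≤ x ∧ x ≤ 0 := by simpa using h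
    rw [h.1, q8 x h.2.1 h.2.2, q8 0 (by omega) (by omega)])
  have K4 := kval (hk 4).2.2.1 (hk 4).2.2.2 _ c hc (by
    intro x y h
    have h := BP_or 4 h
    have h : y = 2 ∧ -L ≤ x ∧ x ≤ 0 := by simpa using h
    rw [h.1, q9 x h.2.1 h.2.2, q9 0 (by omega) (by omega)])
  have b5 := hk 5
  have b6 := hk 6
  have b7 := hk 7
  have b8 := hk 8
  have b9 := hk 9
  have b10 := hk 10
  rw [w0] at K0
  rw [w1] at K1
  rw [w2] at K2
  rw [w3] at K3
  rw [w4] at K4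
  rw [w5] at b5
  rw [w6] at b6
  rw [w7] at b7
  rw [w8] at b8
  rw [w9] at b9
  rw [w10] at b10
  refine arith L la.val lb.val lf.val u v a b c (k 0) (k 1) (k 2) (k 3) (k 4) (k 5) (k 6) (k 7)
    (k 8) (k 9) (k 10) hL (by omega) (by omega) (by omega) ?_ ?_ ?_ ?_ ?_ ?_ K0 K1 K2 K3 K4
    ⟨b5.1, b5.2.1⟩ ⟨b6.1, b6.2.1⟩ ⟨b7.1, b7.2.1⟩ ⟨b8.1, b8.2.1⟩ ⟨b9.1, b9.2.1⟩ ⟨b10.1, b10.2.1⟩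
    (by omega) (by omega)
  · intro h1 h2
    have q := PX_row hcl (hR 0 (by omega) (by omega) (by omega)) 0 0 2
      (by intros; rw [mem_SS]; omega) (by intros; simp [QL]; omega)
    exact ind_eq hu ha (q 2 (by omega) (by omega)).symm
  · intro h1 h2
    have R1 := hR 1 (by omega) (by omega) (by omega)
    have qa := PX_row hcl R1 (-2) 0 (L + 4)
      (by intros; rw [mem_SS]; omega) (by intros; simp [QL]; omega)
    have qb := PX_col hcl R1 (L + 4) (-2) 2
      (by intros; rw [mem_SS]; omega) (by intros; simp [QL])
    have qc := PX_row hcl R1 2 2 (L + 4)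
      (by intros; rw [mem_SS]; omega) (by intros; simp [QL]; omega)
    have e1 := qa (L + 4) (by omega) (by omega)
    have e2 := qb 2 (by omega) (by omega)
    have e3 := qc (L + 4) (by omega) (by omega)
    have e4 : PX X 0 (-2) ↔ PX X 2 2 := by rw [← e1, ← e2, e3]
    refine ⟨ind_eq hb hv e4, ?_⟩
    have K5 := kval (hk 5).2.2.1 (hk 5).2.2.2 _ v hv (by
      intro x y h
      have h := BP_or 5 h
      have h : (y = -2 ∧ 1 ≤ x ∧ x ≤ L + 4) ∨ (x = L + 4 ∧ -1 ≤ y ∧ y ≤ 1) ∨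
        (y = 2 ∧ 3 ≤ x ∧ x ≤ L + 4) := by simpa using h
      rcases h with h | h | h
      · rw [h.1, qa x (by omega) (by omega), e4]
      · rw [h.1, qb y (by omega) (by omega), e1, e4]
      · rw [h.1, qc x (by omega) (by omega)])
    rw [w5] at K5
    exact K5
  · intro h1 h2
    have q := PX_col hcl (hR 2 (by omega) (by omega) (by omega)) 0 0 2
      (by intros; rw [mem_SS]; omega) (by intros; simp [QL]; omega)
    exact ind_eq hu hc (q 2 (by omega) (by omega)).symm
  · intro h1 h2
    have q := PX_col hcl (hR 3 (by omega) (by omega) (by omega)) 2 0 2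
      (by intros; rw [mem_SS]; omega) (by intros; simp [QL]; omega)
    exact ind_eq ha hv (q 2 (by omega) (by omega)).symm
  · intro h1 h2
    have q := PX_col hcl (hR 4 (by omega) (by omega) (by omega)) 0 (-2) 0
      (by intros; rw [mem_SS]; omega) (by intros; simp [QL]; omega)
    exact ind_eq hu hb (q 0 (by omega) (by omega))
  · intro h1 h2
    have q := PX_row hcl (hR 5 (by omega) (by omega) (by omega)) 2 0 2
      (by intros; rw [mem_SS]; omega) (by intros; simp [QL]; omega)
    exact ind_eq hc hv (q 2 (by omega) (by omega)).symm

def EA (L : ℤ) (e : Sym2 (SS L)) : Prop := ∃ i : Fin 11, i.val ≤ 2 ∧ IsLab L i e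
def EB (L : ℤ) (e : Sym2 (SS L)) : Prop := ∃ i : Fin 11, 3 ≤ i.val ∧ i.val ≤ 5 ∧ IsLab L i e

lemma EA_EB {L : ℤ} (hL : 40 ≤ L) {e : Sym2 (SS L)} (he : e ∈ (GG L).edgeSet) (ha : EA L e)
    (hb : EB L e) : False := by
  obtain ⟨i, hi, h1⟩ := ha
  obtain ⟨j, hj, hj', h2⟩ := hb
  have := lab_uniq hL he i j h1 h2
  omega

lemma conn_all {V : Type*} {T : SimpleGraph V} (hT : T.Connected) {Y : Set V}
    (hcl : ∀ p q, T.Adj p q → (p ∈ Y ↔ q ∈ Y)) (p q : V) : p ∈ Y ↔ q ∈ Y :=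
  closed_reach hcl (hT.preconnected p q)

lemma miss_not_pend {L : ℤ} (hL : 40 ≤ L) {T : SimpleGraph (SS L)} (h1 : T ≤ GG L)
    (h2 : T.Connected) {e : Sym2 (SS L)} (he : e ∈ (GG L).edgeSet \ T.edgeSet) :
    EA L e ∨ EB L e := by
  obtain ⟨i, hi⟩ := lab_ex hL he.1
  by_cases h6 : 6 ≤ i.val
  · exfalso
    obtain ⟨Y, p, q, rfl, hp, hq, -, hcl⟩ := pend hL he.1 i h6 hi
    refine hq ((conn_all h2 (fun a b hab => hcl a b (h1 hab) ?_) p q).1 hp)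
    intro h
    apply he.2
    rw [← h]
    exact hab
  · by_cases h3 : i.val ≤ 2
    · exact Or.inl ⟨i, h3, hi⟩
    · exact Or.inr ⟨i, by omega, by omega, hi⟩

lemma invar {L : ℤ} (hL : 40 ≤ L) {ε : ℝ} (hε : ε ≤ L) {T : SimpleGraph (SS L)}
    (hT : MemB (GG L) (fun _ => (1 : ℝ)) 2 ε T) {n n' : Sym2 (SS L)}
    (hn : n ∈ (GG L).edgeSet \ T.edgeSet) (hn' : n' ∈ (GG L).edgeSet \ T.edgeSet)
    (ha : EA L n) (hb : EB L n') : False := by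
  have : Finite (SS L) := SS_finite hL
  obtain ⟨h1, h2, S, hS, hS1, hS2, hS3⟩ := hT
  have hM := miss_card hL h1 h2
  have hne : n ≠ n' := by
    rintro rfl
    exact EA_EB hL hn.1 ha hb
  have hMe : (GG L).edgeSet \ T.edgeSet = {n, n'} := by
    symm
    apply Set.eq_of_subset_of_ncard_le
    · rw [Set.insert_subset_iff, Set.singleton_subset_iff]
      exact ⟨hn, hn'⟩
    · rw [hM, Set.ncard_pair hne]
    · exact Set.toFinite _
  obtain ⟨f, rfl⟩ := Finset.card_eq_one.1 hS1
  have hf : f ∈ T.edgeSet := hS (by simp)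
  have hfG : f ∈ (GG L).edgeSet := SimpleGraph.edgeSet_subset_edgeSet.2 h1 hf
  obtain ⟨c⟩ : Nonempty ((T.deleteEdges (({f} : Finset (Sym2 (SS L))) : Set (Sym2 (SS L)))).ConnectedComponent) :=
    ⟨SimpleGraph.connectedComponentMk _ (vv 0 0 (mem00 hL))⟩
  have hw := hS3 c
  rw [compWeight_one, total_one] at hw
  obtain ⟨hlo, hhi⟩ := hw
  have hcard : (Nat.card (SS L) : ℝ) = 10 * L + 32 := by exact_mod_cast SS_card hL
  rw [hcard] at hlo hhi
  obtain ⟨w, hwc⟩ := c.nonempty_supp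
  have hXcl : ∀ a b, T.Adj a b → s(a, b) ≠ f → (a ∈ c.supp ↔ b ∈ c.supp) := by
    intro a b hab hne
    apply c.mem_supp_congr_adj
    rw [SimpleGraph.deleteEdges_adj]
    exact ⟨hab, by simpa using hne⟩
  generalize c.supp = X at hlo hhi hwc hXcl
  have hlo' : 9 * L + 32 ≤ 2 * (X.ncard : ℤ) := by
    have : (9 * L + 32 : ℝ) ≤ 2 * (X.ncard : ℝ) := by push_cast at hlo; linarith
    exact_mod_cast this
  have hhi' : 2 * (X.ncard : ℤ) ≤ 11 * L + 32 := by
    have : 2 * (X.ncard : ℝ) ≤ (11 * L + 32 : ℝ) := by push_cast at hhi; linarith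
    exact_mod_cast this
  clear hlo hhi hS1 hS2 hS3
  obtain ⟨l, hl⟩ := lab_ex hL hfG
  by_cases h6 : 6 ≤ l.val
  · obtain ⟨Y, p, q, rfl, hp, hq, hYc, hcl⟩ := pend hL hfG l h6 hl
    by_cases hqX : q ∈ X
    · have hall := conn_all h2.1 (Y := X ∪ Y) (by
        intro a b hab
        by_cases hne : s(a, b) = s(p, q)
        · rw [Sym2.eq_iff] at hne
          rcases hne with ⟨rfl, rfl⟩ | ⟨rfl, rfl⟩ <;> simp [hp, hqX]
        · rw [Set.mem_union, Set.mem_union, hXcl a b hab hne, hcl a b (h1 hab) hne])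
      have hu : X ∪ Y = Set.univ := by
        ext r
        simp only [Set.mem_univ, iff_true]
        exact (hall q r).1 (Or.inl hqX)
      have h3 := Set.ncard_union_le X Y
      rw [hu, Set.ncard_univ] at h3
      have := SS_card hL
      omega
    · have hall := conn_all h2.1 (Y := X \ Y) (by
        intro a b hab
        by_cases hne : s(a, b) = s(p, q)
        · rw [Sym2.eq_iff] at hne
          rcases hne with ⟨rfl, rfl⟩ | ⟨rfl, rfl⟩ <;> simp [hp, hqX]
        · rw [Set.mem_sdiff, Set.mem_sdiff, hXcl a b hab hne, hcl a b (h1 hab) hne])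
      have hu : X ⊆ Y := by
        intro r hr
        by_contra hrY
        exact hqX ((hall r q).1 ⟨hr, hrY⟩).1
      have h3 := Set.ncard_le_ncard hu (Set.toFinite _)
      omega
  · obtain ⟨la, hla, hna⟩ := ha
    obtain ⟨lb, hlb, hlb', hnb⟩ := hb
    refine core hL (X := X) (R := {n, n', f}) ?_ la lb l hla ⟨hlb, hlb'⟩ (by omega) ?_ hlo' hhi'
    · intro a b hab hR
      simp only [Set.mem_insert_iff, Set.mem_singleton_iff, not_or] at hR
      refine hXcl a b ?_ hR.2.2
      by_contra hT
      have : s(a, b) ∈ (GG L).edgeSet \ T.edgeSet := ⟨hab, hT⟩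
      rw [hMe] at this
      rcases this with h | h
      · exact hR.1 h
      · exact hR.2.1 h
    · rintro i hi1 hi2 hi3 e he hie
      simp only [Set.mem_insert_iff, Set.mem_singleton_iff] at he
      rcases he with rfl | rfl | rfl
      · exact hi1 (lab_uniq hL hn.1 i la hie hna)
      · exact hi2 (lab_uniq hL hn'.1 i lb hie hnb)
      · exact hi3 (lab_uniq hL hfG i l hie hl)

lemma step_pres {L : ℤ} (hL : 40 ≤ L) {ε : ℝ} (hε : ε ≤ L) {T T' : SimpleGraph (SS L)}
    (hs : BUDStep (GG L) (fun _ => (1 : ℝ)) 2 ε T T')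
    (h : ∀ e ∈ (GG L).edgeSet \ T.edgeSet, EA L e) :
    ∀ e ∈ (GG L).edgeSet \ T'.edgeSet, EA L e := by
  obtain ⟨hT, hT', e, he, f, hf, rfl⟩ := hs
  have hM := miss_card hL hT.1 hT.2.1
  obtain ⟨g, hg, hge⟩ := Set.exists_ne_of_one_lt_ncard (s := (GG L).edgeSet \ T.edgeSet) (by omega) e
  have hg' : g ∈ (GG L).edgeSet \ ((T ⊔ SimpleGraph.fromEdgeSet {e}).deleteEdges {f}).edgeSet := by
    refine ⟨hg.1, fun hh => ?_⟩
    rw [SimpleGraph.edgeSet_deleteEdges, SimpleGraph.edgeSet_sup, SimpleGraph.edgeSet_fromEdgeSet] at hh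
    rcases hh.1 with h3 | h3
    · exact hg.2 h3
    · exact hge h3.1
  intro e' he'
  rcases miss_not_pend hL hT'.1 hT'.2.1.1 he' with h4 | h4
  · exact h4
  · exact (invar hL hε hT' hg' he' (h g hg) h4).elim

theorem stmt11 (ε : ℝ) (hε : 0 ≤ ε) :
    ∃ S : Set (ℤ × ℤ), S.Finite ∧ (latticeGraph.induce S).Connected ∧
      ∃ T T' : SimpleGraph ↥S,
        MemB (latticeGraph.induce S) (fun _ => (1 : ℝ)) 2 ε T ∧
        MemB (latticeGraph.induce S) (fun _ => (1 : ℝ)) 2 ε T' ∧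
        ¬ ∃ (m : ℕ) (c : ℕ → SimpleGraph ↥S), c 0 = T ∧ c m = T' ∧
            ∀ i < m, BUDStep (latticeGraph.induce S) (fun _ => (1 : ℝ)) 2 ε
              (c i) (c (i + 1)) := by
  obtain ⟨L, hL, hεL⟩ : ∃ L : ℤ, 40 ≤ L ∧ ε ≤ L :=
    ⟨max 40 ⌈ε⌉, le_max_left _ _, (Int.le_ceil ε).trans (by exact_mod_cast le_max_right _ _)⟩
  have hA := TA_memB hL hε
  have hB := TB_memB hL hε
  refine ⟨SS L, SS_finite hL, hA.2.1.1.mono hA.1, TA hL, TB hL, hA, hB, ?_⟩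
  rintro ⟨m, c, h0, hm, hst⟩
  have hind : ∀ i ≤ m, ∀ e ∈ (GG L).edgeSet \ (c i).edgeSet, EA L e := by
    intro i
    induction i with
    | zero =>
      intro _ e he
      rw [h0] at he
      rcases miss_not_pend hL hA.1 hA.2.1.1 he with h4 | h4
      · exact h4
      · refine (invar hL hεL hA (n := e1 hL) ⟨?_, (not_TA hL).1⟩ he ⟨2, by decide, ?_⟩ h4).elim
        · rw [GG_edgeSet hL]; simp
        · rw [e1, isLab_mk]; simp [QL, vv]
    | succ i ih =>
      intro hi
      exact step_pres hL hεL (hst i (by omega)) (ih (by omega))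
  have hin : s(vv 0 0 (mem00 hL), vv 0 (-1) (mem0m1 hL)) ∈ (GG L).edgeSet := by
    rw [SimpleGraph.mem_edgeSet, GG_adj]; simp [vv]
  have hfin := hind m le_rfl s(vv 0 0 (mem00 hL), vv 0 (-1) (mem0m1 hL))
    ⟨hin, by rw [hm]; exact not_TB hL⟩
  refine EA_EB hL hin hfin ⟨4, by decide, by decide, ?_⟩
  rw [isLab_mk]; simp [QL, vv]
end

section
/- For any ε > 0 and any sets A_1, …, A_d ⊆ ℝ, the ε-closure of the Minkowski sum of the ε-closures equals the ε-closure of the Minkowski sum: C_ε(C_ε(A_1) + ⋯ + C_ε(A_d)) = C_ε(A_1 + ⋯ + A_d). -/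
open Pointwise

/-- The ε-closure of a set `S ⊆ ℝ`:
`C_ε(S) = {y : ∃ x, z ∈ S, x ≤ y ≤ z ≤ x + ε}`. -/
def eClosure (ε : ℝ) (S : Set ℝ) : Set ℝ :=
  {y | ∃ x ∈ S, ∃ z ∈ S, x ≤ y ∧ y ≤ z ∧ z ≤ x + ε}

theorem eC_sub {ε : ℝ} (hε : 0 < ε) (S : Set ℝ) : S ⊆ eClosure ε S :=
  fun x hx => ⟨x, hx, x, hx, le_rfl, le_rfl, by linarith⟩

theorem eC_mono {ε : ℝ} {S T : Set ℝ} (h : S ⊆ T) : eClosure ε S ⊆ eClosure ε T := by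
  rintro y ⟨x, hx, z, hz, h1⟩
  exact ⟨x, h hx, z, h hz, h1⟩

theorem eC_idem {ε : ℝ} (S : Set ℝ) : eClosure ε (eClosure ε S) ⊆ eClosure ε S := by
  rintro y ⟨x, ⟨x1, hx1, x2, hx2, h1, h2, h3⟩, z, ⟨z1, hz1, z2, hz2, h4, h5, h6⟩, h7, h8, h9⟩
  by_cases ha : y ≤ x2
  · exact ⟨x1, hx1, x2, hx2, by linarith, ha, h3⟩
  by_cases hb : z1 ≤ y
  · exact ⟨z1, hz1, z2, hz2, hb, by linarith, h6⟩
  exact ⟨x2, hx2, z1, hz1, by linarith, by linarith, by linarith⟩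

theorem eC_add {ε : ℝ} (S T : Set ℝ) :
    eClosure ε S + eClosure ε T ⊆ eClosure ε (S + T) := by
  rintro y ⟨a, ⟨a1, ha1, a2, ha2, h1, h2, h3⟩, b, ⟨b1, hb1, b2, hb2, h4, h5, h6⟩, rfl⟩
  simp only
  by_cases hc : a + b ≤ a1 + b2
  · exact ⟨a1 + b1, Set.add_mem_add ha1 hb1, a1 + b2, Set.add_mem_add ha1 hb2,
      by linarith, hc, by linarith⟩
  · exact ⟨a1 + b2, Set.add_mem_add ha1 hb2, a2 + b2, Set.add_mem_add ha2 hb2,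
      by linarith, by linarith, by linarith⟩

theorem eC_sum {ε : ℝ} (hε : 0 < ε) {d : ℕ} (A : Fin d → Set ℝ) (s : Finset (Fin d)) :
    ∑ i ∈ s, eClosure ε (A i) ⊆ eClosure ε (∑ i ∈ s, A i) := by
  induction s using Finset.induction_on with
  | empty => simpa only [Finset.sum_empty] using eC_sub hε _
  | insert a s ha ih =>
    rw [Finset.sum_insert ha, Finset.sum_insert ha]
    exact (Set.add_subset_add_left ih).trans (eC_add _ _)

theorem eC_sum' {ε : ℝ} (hε : 0 < ε) {d : ℕ} (A : Fin d → Set ℝ) (s : Finset (Fin d)) :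
    ∑ i ∈ s, A i ⊆ ∑ i ∈ s, eClosure ε (A i) := by
  induction s using Finset.induction_on with
  | empty => simp
  | insert a s ha ih =>
    rw [Finset.sum_insert ha, Finset.sum_insert ha]
    exact Set.add_subset_add (eC_sub hε _) ih

theorem stmt12 (ε : ℝ) (hε : 0 < ε) (d : ℕ) (A : Fin d → Set ℝ) :
    eClosure ε (∑ i, eClosure ε (A i)) = eClosure ε (∑ i, A i) := by
  exact Set.Subset.antisymm ((eC_mono (eC_sum hε A _)).trans (eC_idem _))
    (eC_mono (eC_sum' hε A _))
end

section
/- Fix M ∈ ℝ and ε > 0, and let Ψ(A) = A ∩ (−∞, M]. For every closed set A ⊆ ℝ, one has (Ψ ∘ C_ε)(A) ∼ (C_ε ∘ Ψ)(A). -/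
/-- The relation `S₁ ∼ S₂` (relative to `M` and `ε`): the two sets agree on
`(-∞, M - ε]`, and their parts in `[M - ε, ∞)` are either both empty or both
nonempty with equal infima. -/
def simRel (M ε : ℝ) (S₁ S₂ : Set ℝ) : Prop :=
  S₁ ∩ Set.Iic (M - ε) = S₂ ∩ Set.Iic (M - ε) ∧
  ((S₁ ∩ Set.Ici (M - ε) = ∅ ∧ S₂ ∩ Set.Ici (M - ε) = ∅) ∨
   ((S₁ ∩ Set.Ici (M - ε)).Nonempty ∧ (S₂ ∩ Set.Ici (M - ε)).Nonempty ∧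
     sInf (S₁ ∩ Set.Ici (M - ε)) = sInf (S₂ ∩ Set.Ici (M - ε))))

/-- `(Ψ ∘ C_ε)(A) ∼ (C_ε ∘ Ψ)(A)` for closed `A`, where `Ψ(A) = A ∩ (-∞, M]`. -/
theorem stmt13 (M ε : ℝ) (hε : 0 < ε) (A : Set ℝ) (hA : IsClosed A) :
    simRel M ε (eClosure ε A ∩ Set.Iic M) (eClosure ε (A ∩ Set.Iic M)) := by
  have hsub : eClosure ε (A ∩ Set.Iic M) ⊆ eClosure ε A ∩ Set.Iic M := by
    rintro y ⟨x, hx, z, hz, h1, h2, h3⟩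
    exact ⟨⟨x, hx.1, z, hz.1, h1, h2, h3⟩, le_trans h2 hz.2⟩
  have hdom : ∀ y ∈ (eClosure ε A ∩ Set.Iic M) ∩ Set.Ici (M - ε),
      ∃ w ∈ eClosure ε (A ∩ Set.Iic M) ∩ Set.Ici (M - ε), w ≤ y := by
    rintro y ⟨⟨⟨x, hx, z, hz, h1, h2, h3⟩, hM⟩, hy⟩
    have hxM : x ≤ M := le_trans h1 hM
    by_cases hzM : z ≤ M
    · exact ⟨y, ⟨⟨x, ⟨hx, hxM⟩, z, ⟨hz, hzM⟩, h1, h2, h3⟩, hy⟩, le_rfl⟩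
    · refine ⟨x, ⟨⟨x, ⟨hx, hxM⟩, x, ⟨hx, hxM⟩, le_rfl, le_rfl, by linarith⟩, ?_⟩, h1⟩
      rw [Set.mem_Ici]
      linarith
  have hsub2 := Set.inter_subset_inter_left (Set.Ici (M - ε)) hsub
  have hb1 : BddBelow ((eClosure ε A ∩ Set.Iic M) ∩ Set.Ici (M - ε)) := ⟨M - ε, fun y hy => hy.2⟩
  have hb2 : BddBelow (eClosure ε (A ∩ Set.Iic M) ∩ Set.Ici (M - ε)) := ⟨M - ε, fun y hy => hy.2⟩
  refine ⟨?_, ?_⟩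
  · apply Set.Subset.antisymm
    · rintro y ⟨⟨⟨x, hx, z, hz, h1, h2, h3⟩, hM⟩, hy⟩
      rw [Set.mem_Iic] at hy hM
      refine ⟨⟨x, ⟨hx, le_trans h1 hM⟩, z, ⟨hz, ?_⟩, h1, h2, h3⟩, hy⟩
      rw [Set.mem_Iic]
      linarith
    · exact Set.inter_subset_inter_left _ hsub
  · rcases Set.eq_empty_or_nonempty ((eClosure ε A ∩ Set.Iic M) ∩ Set.Ici (M - ε)) with h | h
    · exact Or.inl ⟨h, Set.subset_eq_empty hsub2 h⟩
    · have h' : (eClosure ε (A ∩ Set.Iic M) ∩ Set.Ici (M - ε)).Nonempty := by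
        obtain ⟨y, hy⟩ := h
        obtain ⟨w, hw, _⟩ := hdom y hy
        exact ⟨w, hw⟩
      refine Or.inr ⟨h, h', le_antisymm (csInf_le_csInf hb1 h' hsub2) (le_csInf h ?_)⟩
      intro y hy
      obtain ⟨w, hw, hwy⟩ := hdom y hy
      exact (csInf_le hb2 hw).trans hwy
end

section
/- Fix M ∈ ℝ and ε > 0, and let Ψ(A) = A ∩ (−∞, M]. If A, B ⊆ ℝ are closed sets with A ∼ B, then C_ε(A) ∼ C_ε(B), Ψ(A) ∼ Ψ(B), and (Ψ ∘ C_ε)(A) ∼ (Ψ ∘ C_ε)(B). -/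
def simRelL (M ε : ℝ) (S T : Set ℝ) : Prop :=
  (∀ x ≤ M - ε, x ∈ S ↔ x ∈ T) ∧
  (((∀ x ∈ S, x < M - ε) ∧ (∀ x ∈ T, x < M - ε)) ∨
   ∃ m, IsLeast (S ∩ Set.Ici (M - ε)) m ∧ IsLeast (T ∩ Set.Ici (M - ε)) m)

theorem simRelL.toRel {M ε : ℝ} {S T : Set ℝ} (h : simRelL M ε S T) : simRel M ε S T := by
  obtain ⟨h1, h2⟩ := h
  refine ⟨?_, ?_⟩
  · ext x
    simp only [Set.mem_inter_iff, Set.mem_Iic]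
    constructor
    · rintro ⟨a, b⟩; exact ⟨(h1 x b).1 a, b⟩
    · rintro ⟨a, b⟩; exact ⟨(h1 x b).2 a, b⟩
  · rcases h2 with ⟨a, b⟩ | ⟨m, a, b⟩
    · left
      constructor
      · ext x
        simp only [Set.mem_inter_iff, Set.mem_Ici, Set.mem_empty_iff_false, iff_false]
        rintro ⟨u, v⟩; linarith [a x u]
      · ext x
        simp only [Set.mem_inter_iff, Set.mem_Ici, Set.mem_empty_iff_false, iff_false]
        rintro ⟨u, v⟩; linarith [b x u]
    · right
      exact ⟨a.nonempty, b.nonempty, by rw [a.csInf_eq, b.csInf_eq]⟩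

theorem simRel.toL {M ε : ℝ} {S T : Set ℝ} (hS : IsClosed S) (hT : IsClosed T)
    (h : simRel M ε S T) : simRelL M ε S T := by
  obtain ⟨h1, h2⟩ := h
  refine ⟨?_, ?_⟩
  · intro x hx
    have := Set.ext_iff.1 h1 x
    simpa [hx] using this
  · rcases h2 with ⟨a, b⟩ | ⟨a, b, c⟩
    · left
      constructor
      · intro x hx
        by_contra hc
        exact Set.notMem_empty x (a ▸ ⟨hx, not_lt.1 hc⟩)
      · intro x hx
        by_contra hc
        exact Set.notMem_empty x (b ▸ ⟨hx, not_lt.1 hc⟩)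
    · right
      refine ⟨_, (hS.inter isClosed_Ici).isLeast_csInf a ⟨M - ε, fun x hx => hx.2⟩, ?_⟩
      rw [c]
      exact (hT.inter isClosed_Ici).isLeast_csInf b ⟨M - ε, fun x hx => hx.2⟩

theorem simRelL.psi {M ε : ℝ} {S T : Set ℝ} (h : simRelL M ε S T) (hε : 0 < ε) :
    simRelL M ε (S ∩ Set.Iic M) (T ∩ Set.Iic M) := by
  obtain ⟨h1, h2⟩ := h
  refine ⟨fun x hx => and_congr_left fun _ => h1 x hx, ?_⟩
  rcases h2 with ⟨a, b⟩ | ⟨m, a, b⟩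
  · exact Or.inl ⟨fun x hx => a x hx.1, fun x hx => b x hx.1⟩
  · by_cases hm : m ≤ M
    · right
      exact ⟨m, ⟨⟨⟨a.1.1, hm⟩, a.1.2⟩, fun x hx => a.2 ⟨hx.1.1, hx.2⟩⟩,
        ⟨⟨⟨b.1.1, hm⟩, b.1.2⟩, fun x hx => b.2 ⟨hx.1.1, hx.2⟩⟩⟩
    · left
      constructor
      · rintro x ⟨u, v⟩
        by_contra hc
        exact hm ((a.2 ⟨u, not_lt.1 hc⟩).trans v)
      · rintro x ⟨u, v⟩
        by_contra hc
        exact hm ((b.2 ⟨u, not_lt.1 hc⟩).trans v)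

theorem simRelL.symm' {M ε : ℝ} {S T : Set ℝ} (h : simRelL M ε S T) : simRelL M ε T S :=
  ⟨fun x hx => (h.1 x hx).symm, h.2.imp And.symm fun ⟨m, a, b⟩ => ⟨m, b, a⟩⟩

theorem simRelL.sub {M ε : ℝ} {S T : Set ℝ} (h : simRelL M ε S T) {y : ℝ} (hy : y ≤ M - ε)
    (hyS : y ∈ eClosure ε S) : y ∈ eClosure ε T := by
  obtain ⟨x, hx, z, hz, hxy, hyz, hzx⟩ := hyS
  obtain ⟨h1, h2⟩ := h
  have hxT := (h1 x (hxy.trans hy)).1 hx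
  rcases le_total z (M - ε) with hzM | hzM
  · exact ⟨x, hxT, z, (h1 z hzM).1 hz, hxy, hyz, hzx⟩
  · rcases h2 with ⟨a, b⟩ | ⟨m, a, b⟩
    · linarith [a z hz]
    · exact ⟨x, hxT, m, b.1.1, hxy, hy.trans b.1.2, (a.2 ⟨hz, hzM⟩).trans hzx⟩

theorem least_one {c ε m : ℝ} {S : Set ℝ} (hm : IsLeast (S ∩ Set.Ici c) m)
    (h : ∃ x ∈ S, x ≤ c ∧ m ≤ x + ε) : IsLeast (eClosure ε S ∩ Set.Ici c) c := by
  obtain ⟨x, hx, hxc, hmx⟩ := h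
  exact ⟨⟨⟨x, hx, m, hm.1.1, hxc, hm.1.2, hmx⟩, le_refl c⟩, fun y hy => hy.2⟩

theorem least_two {c ε m : ℝ} (hε : 0 < ε) {S : Set ℝ} (hm : IsLeast (S ∩ Set.Ici c) m)
    (h : ¬ ∃ x ∈ S, x ≤ c ∧ m ≤ x + ε) : IsLeast (eClosure ε S ∩ Set.Ici c) m := by
  refine ⟨⟨⟨m, hm.1.1, m, hm.1.1, le_refl m, le_refl m, by linarith⟩, hm.1.2⟩, ?_⟩
  rintro y ⟨⟨x, hx, z, hz, hxy, hyz, hzx⟩, hy⟩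
  have hy' : c ≤ y := hy
  rcases le_total x c with hxc | hxc
  · exact absurd ⟨x, hx, hxc, (hm.2 ⟨hz, hy'.trans hyz⟩).trans hzx⟩ h
  · exact (hm.2 ⟨hx, hxc⟩).trans hxy

theorem simRelL.clos {M ε : ℝ} {S T : Set ℝ} (h : simRelL M ε S T) (hε : 0 < ε) :
    simRelL M ε (eClosure ε S) (eClosure ε T) := by
  refine ⟨fun x hx => ⟨h.sub hx, h.symm'.sub hx⟩, ?_⟩
  obtain ⟨h1, h2⟩ := h
  rcases h2 with ⟨a, b⟩ | ⟨m, a, b⟩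
  · left
    constructor
    · rintro y ⟨x, hx, z, hz, hxy, hyz, hzx⟩
      exact hyz.trans_lt (a z hz)
    · rintro y ⟨x, hx, z, hz, hxy, hyz, hzx⟩
      exact hyz.trans_lt (b z hz)
  · right
    have e : (∃ x ∈ S, x ≤ M - ε ∧ m ≤ x + ε) ↔ (∃ x ∈ T, x ≤ M - ε ∧ m ≤ x + ε) := by
      constructor
      · rintro ⟨x, u, v, w⟩; exact ⟨x, (h1 x v).1 u, v, w⟩
      · rintro ⟨x, u, v, w⟩; exact ⟨x, (h1 x v).2 u, v, w⟩
    by_cases hc : ∃ x ∈ S, x ≤ M - ε ∧ m ≤ x + ε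
    · exact ⟨_, least_one a hc, least_one b (e.1 hc)⟩
    · exact ⟨_, least_two hε a hc, least_two hε b (fun t => hc (e.2 t))⟩

/-- If closed sets `A ∼ B`, then `C_ε(A) ∼ C_ε(B)`, `Ψ(A) ∼ Ψ(B)`, and
`(Ψ ∘ C_ε)(A) ∼ (Ψ ∘ C_ε)(B)`, where `Ψ(A) = A ∩ (-∞, M]`. -/
theorem stmt14 (M ε : ℝ) (hε : 0 < ε) (A B : Set ℝ)
    (hA : IsClosed A) (hB : IsClosed B) (hAB : simRel M ε A B) :
    simRel M ε (eClosure ε A) (eClosure ε B) ∧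
    simRel M ε (A ∩ Set.Iic M) (B ∩ Set.Iic M) ∧
    simRel M ε (eClosure ε A ∩ Set.Iic M) (eClosure ε B ∩ Set.Iic M) := by
  have h := simRel.toL hA hB hAB
  exact ⟨(h.clos hε).toRel, (h.psi hε).toRel, ((h.clos hε).psi hε).toRel⟩
end

section
/- For any ε > 0, any a ∈ ℝ, and any positive integer l, if S ⊆ [a, a + l·ε], then the ε-closure C_ε(S) has at most l connected components (as a subspace of ℝ). -/
theorem aux_same (C : Set ℝ) (x y : C) (hxy : (x : ℝ) ≤ y) (h : Set.Icc (x : ℝ) y ⊆ C) :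
    (ConnectedComponents.mk x) = ConnectedComponents.mk y := by
  rw [ConnectedComponents.coe_eq_coe']
  have hp : IsPreconnected ((Subtype.val : C → ℝ) ⁻¹' Set.Icc (x : ℝ) y) := by
    rw [← Topology.IsInducing.subtypeVal.isPreconnected_image, Subtype.image_preimage_coe,
      Set.inter_eq_right.2 h]
    exact isPreconnected_Icc
  exact hp.subset_connectedComponent (x := y) ⟨hxy, le_refl _⟩ ⟨le_refl _, hxy⟩

theorem aux_close (ε : ℝ) (S : Set ℝ) (x y : eClosure ε S) (hx : (x : ℝ) ∈ S) (hy : (y : ℝ) ∈ S)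
    (hxy : (x : ℝ) ≤ y) (h : (y : ℝ) ≤ x + ε) :
    (ConnectedComponents.mk x) = ConnectedComponents.mk y :=
  aux_same _ x y hxy fun _ ht => ⟨x, hx, y, hy, ht.1, ht.2, h⟩

/-- If `S ⊆ [a, a + l·ε]`, then `C_ε(S)` has at most `l` connected components
(as a subspace of `ℝ`). -/
theorem stmt18 (ε : ℝ) (hε : 0 < ε) (a : ℝ) (l : ℕ) (hl : 0 < l)
    (S : Set ℝ) (hS : S ⊆ Set.Icc a (a + l * ε)) :
    ∃ f : ConnectedComponents ↥(eClosure ε S) → Fin l, Function.Injective f := by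
  have rep : ∀ c : ConnectedComponents ↥(eClosure ε S), ∃ x : eClosure ε S,
      (x : ℝ) ∈ S ∧ ConnectedComponents.mk x = c := by
    intro c
    obtain ⟨y, rfl⟩ := ConnectedComponents.surjective_coe c
    obtain ⟨x, hx, z, hz, h1, h2, h3⟩ := y.2
    refine ⟨⟨x, x, hx, x, hx, le_refl _, le_refl _, by linarith⟩, hx, ?_⟩
    exact aux_same _ _ _ h1 fun t ht => ⟨x, hx, z, hz, ht.1, ht.2.trans h2, h3⟩
  choose s hs hsc using rep
  have hb : ∀ c, ⌈((s c : ℝ) - a) / ε⌉₊ ≤ l := by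
    intro c
    rw [Nat.ceil_le, div_le_iff₀ hε]
    linarith [(hS (hs c)).2]
  have hup : ∀ c, (s c : ℝ) - a ≤ ((⌈((s c : ℝ) - a) / ε⌉₊ - 1 : ℕ) + 1 : ℝ) * ε := by
    intro c
    rw [← div_le_iff₀ hε]
    refine (Nat.le_ceil _).trans ?_
    exact_mod_cast (by omega)
  have hlo : ∀ c, ((⌈((s c : ℝ) - a) / ε⌉₊ - 1 : ℕ) : ℝ) * ε ≤ (s c : ℝ) - a := by
    intro c
    have h0 : 0 ≤ (s c : ℝ) - a := by linarith [(hS (hs c)).1]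
    rw [← le_div_iff₀ hε]
    rcases Nat.eq_zero_or_pos (⌈((s c : ℝ) - a) / ε⌉₊ - 1) with h | h
    · rw [h]; simp only [Nat.cast_zero]; positivity
    · exact (Nat.lt_ceil.1 (by omega)).le
  refine ⟨fun c => ⟨⌈((s c : ℝ) - a) / ε⌉₊ - 1, by have := hb c; omega⟩, ?_⟩
  intro c d hcd
  have hcd' := congrArg Fin.val hcd
  simp only at hcd'
  have h1 := hup c
  have h2 := hlo c
  have h3 := hup d
  have h4 := hlo d
  rw [hcd'] at h1 h2
  rw [← hsc c, ← hsc d]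
  rcases le_total (s c : ℝ) (s d) with h | h
  · exact aux_close ε S _ _ (hs c) (hs d) h (by linarith)
  · exact (aux_close ε S _ _ (hs d) (hs c) h (by linarith)).symm
end

section
/- Fix an integer k ≥ 2 and 0 < ε < 2/(3k). Let T be a finite tree with nonnegative vertex weights summing to 1 that is ℓ-splittable for some ℓ, in which every leaf is a district. Then for every leaf v of T, every viable edge of v lies on the branch B_v; that is, V_v ⊆ B_v. -/
open SimpleGraph

/-- The total weight of a set of vertices. -/
noncomputable def setWeight {V : Type*} (w : V → ℝ) (s : Set V) : ℝ :=
  ∑ᶠ v ∈ s, w v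

/-- A set of vertices is a district if its total weight lies within `± ε/2` of
the ideal district weight `1/k`. -/
def IsDistrict {V : Type*} (w : V → ℝ) (k : ℕ) (ε : ℝ) (s : Set V) : Prop :=
  setWeight w s ∈ Set.Icc (1 / (k : ℝ) - ε / 2) (1 / (k : ℝ) + ε / 2)

/-- `T` is `l`-splittable: some set of `l - 1` edges of `T` can be removed so
that each of the resulting `l` connected components is a district. -/
def LSplittable {V : Type*} (T : SimpleGraph V) (w : V → ℝ) (k : ℕ) (ε : ℝ)
    (l : ℕ) : Prop :=
  ∃ S : Finset (Sym2 V), (S : Set (Sym2 V)) ⊆ T.edgeSet ∧ S.card = l - 1 ∧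
    Nat.card (T.deleteEdges (S : Set (Sym2 V))).ConnectedComponent = l ∧
    ∀ c : (T.deleteEdges (S : Set (Sym2 V))).ConnectedComponent,
      IsDistrict w k ε c.supp

/-- `v` is a leaf of `T`: it has exactly one neighbor. -/
def IsLeaf {V : Type*} (T : SimpleGraph V) (v : V) : Prop :=
  Nat.card ↥(T.neighborSet v) = 1

/-- `e` is an edge of the branch `B_v` of the leaf `v` of the tree `T`: the
path from `v` to the closest vertex of degree at least 3 (the whole tree when
the maximum degree is less than 3).  Equivalently, `e` is an edge of `T` such
that every vertex on the `v`-side of `T - e` has degree at most 2. -/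
def BranchEdge {V : Type*} (T : SimpleGraph V) (v : V) (e : Sym2 V) : Prop :=
  e ∈ T.edgeSet ∧
  ∀ u, (T.deleteEdges {e}).Reachable v u → Nat.card ↥(T.neighborSet u) ≤ 2

/-- `e` is a viable edge of the leaf `v`: deleting `e` yields a district `T_v`
containing `v`, and the remaining subtree is `(k-1)`-splittable. -/
def ViableEdge {V : Type*} (T : SimpleGraph V) (w : V → ℝ) (k : ℕ) (ε : ℝ)
    (v : V) (e : Sym2 V) : Prop :=
  e ∈ T.edgeSet ∧
  IsDistrict w k ε {u | (T.deleteEdges {e}).Reachable v u} ∧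
  LSplittable (T.induce {u | ¬ (T.deleteEdges {e}).Reachable v u})
    (fun u => w u.1) k ε (k - 1)

theorem aux19_leaf {V : Type*} [Fintype V] (T : SimpleGraph V) (hT : T.IsTree)
    (v : V) (hv : IsLeaf T v) (e : Sym2 V) (u : V)
    (hu : (T.deleteEdges {e}).Reachable v u) (h3 : 2 < Nat.card ↥(T.neighborSet u)) :
    ∃ x, x ≠ v ∧ (T.deleteEdges {e}).Reachable v x ∧ IsLeaf T x := by
  classical
  by_contra hcon
  push Not at hcon
  set A : Set V := {x | (T.deleteEdges {e}).Reachable v x} with hA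
  have hvA : v ∈ A := Reachable.refl _
  have huA : u ∈ A := hu
  unfold IsLeaf at hv hcon
  have huv : u ≠ v := by rintro rfl; omega
  haveI : Nontrivial V := ⟨u, v, huv⟩
  have hd : ∀ x, Nat.card ↥(T.neighborSet x) = T.degree x := by
    intro x
    rw [Nat.card_eq_fintype_card, card_neighborSet_eq_degree]
  have hcross : ∀ x ∈ A, ∀ y, y ∉ A → T.Adj x y → s(x, y) = e := by
    intro x hx y hy hxy
    by_contra hne
    apply hy
    refine Reachable.trans (show (T.deleteEdges {e}).Reachable v x from hx) (Adj.reachable ?_)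
    rw [deleteEdges_adj]
    exact ⟨hxy, by simpa using hne⟩
  obtain ⟨a, b, haA, hab⟩ : ∃ a b, a ∈ A ∧ ∀ x ∈ A, ∀ y, y ∉ A → T.Adj x y → x = a ∧ y = b := by
    by_cases h : ∃ a ∈ A, ∃ b, b ∉ A ∧ T.Adj a b
    · obtain ⟨a, ha, b, hb, hadj⟩ := h
      refine ⟨a, b, ha, fun x hx y hy hxy => ?_⟩
      have h1 := hcross a ha b hb hadj
      have h2 := hcross x hx y hy hxy
      rw [← h1, Sym2.eq_iff] at h2
      rcases h2 with h2 | ⟨rfl, rfl⟩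
      · exact h2
      · exact absurd hx hb
    · push Not at h
      exact ⟨v, v, hvA, fun x hx y hy hxy => absurd hxy (h x hx y hy)⟩
  set H := T.induce A with hH
  have hHc : H.Connected := by
    have h1 := ((T.deleteEdges {e}).connectedComponentMk v).connected_toSimpleGraph
    have hs : ((T.deleteEdges {e}).connectedComponentMk v).supp = A := by
      ext x
      simp only [ConnectedComponent.mem_supp_iff, ConnectedComponent.eq, hA, Set.mem_setOf_eq]
      exact ⟨fun h => h.symm, fun h => h.symm⟩
    have h2 : ((T.deleteEdges {e}).induce A).Connected := by
      rw [← hs]; exact h1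
    refine h2.mono ?_
    intro x y hxy
    exact (deleteEdges_le {e}) hxy
  have hHT : H.IsTree := ⟨hHc, hT.isAcyclic.induce A⟩
  have hcard := hHT.card_edgeFinset
  have hsum := H.sum_degrees_eq_twice_card_edges
  have hdeg : ∀ x : A, T.degree x ≤ H.degree x + if x = ⟨a, haA⟩ then 1 else 0 := by
    intro x
    have hsub : T.neighborFinset x ⊆
        (H.neighborFinset x).image Subtype.val ∪ if x = ⟨a, haA⟩ then {b} else ∅ := by
      intro y hy
      rw [mem_neighborFinset] at hy
      by_cases hyA : y ∈ A
      · refine Finset.mem_union_left _ (Finset.mem_image.2 ⟨⟨y, hyA⟩, ?_, rfl⟩)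
        rw [mem_neighborFinset]
        exact hy
      · obtain ⟨h1, h2⟩ := hab x x.2 y hyA hy
        have : x = ⟨a, haA⟩ := Subtype.ext h1
        simp [this, h2]
    have := (Finset.card_le_card hsub).trans (Finset.card_union_le _ _)
    have h2 : ((H.neighborFinset x).image Subtype.val).card ≤ H.degree x := by
      rw [← card_neighborFinset_eq_degree]; exact Finset.card_image_le
    rw [card_neighborFinset_eq_degree] at this
    split_ifs at this ⊢ <;> simp at this ⊢ <;> omega
  have hlow : ∀ x : A, 2 + (if x = ⟨u, huA⟩ then 1 else 0) ≤
      T.degree x + if x = ⟨v, hvA⟩ then 1 else 0 := by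
    intro x
    have hpos := hT.1.preconnected.degree_pos_of_nontrivial (x : V)
    have h1 := hcon x
    have h2 := hd x
    by_cases hxv : x = ⟨v, hvA⟩
    · have : x ≠ ⟨u, huA⟩ := by rintro rfl; exact huv (congrArg Subtype.val hxv)
      rw [if_neg this, if_pos hxv]
      omega
    · have h4 : (x : V) ≠ v := fun h => hxv (Subtype.ext h)
      have h5 := h1 h4 x.2
      by_cases hxu : x = ⟨u, huA⟩
      · have : T.degree (x : V) = T.degree u := by rw [hxu]
        have := hd u
        simp only [hxu, if_true] at *
        omega
      · simp only [hxu, hxv, if_false]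
        omega
  have S1 := Finset.sum_le_sum (fun x (_ : x ∈ Finset.univ) => hdeg x)
  have S2 := Finset.sum_le_sum (fun x (_ : x ∈ Finset.univ) => hlow x)
  simp only [Finset.sum_add_distrib, Finset.sum_ite_eq', Finset.mem_univ, if_true,
    Finset.sum_const, Finset.card_univ, smul_eq_mul] at S1 S2
  omega

theorem stmt19 {V : Type*} [Fintype V] (k : ℕ) (hk : 2 ≤ k) (ε : ℝ)
    (hε : 0 < ε) (hε' : ε < 2 / (3 * (k : ℝ)))
    (T : SimpleGraph V) (hT : T.IsTree)
    (w : V → ℝ) (hw : ∀ v, 0 ≤ w v) (hw1 : ∑ᶠ v, w v = 1)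
    (l : ℕ) (hl : LSplittable T w k ε l)
    (hleaf : ∀ v, IsLeaf T v → IsDistrict w k ε {v})
    (v : V) (hv : IsLeaf T v)
    (e : Sym2 V) (he : ViableEdge T w k ε v e) :
    BranchEdge T v e := by
  classical
  obtain ⟨he1, he2, -⟩ := he
  refine ⟨he1, fun u hu => ?_⟩
  by_contra h3
  obtain ⟨x, hxv, hx, hxl⟩ := aux19_leaf T hT v hv e u hu (by omega)
  have h1 := (hleaf v hv).1
  have h2 := (hleaf x hxl).1
  have h4 := he2.2
  unfold setWeight at h1 h2 h4
  rw [finsum_mem_singleton] at h1 h2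
  rw [finsum_mem_eq_toFinset_sum] at h4
  have h5 : ∑ y ∈ ({v, x} : Finset V), w y ≤
      ∑ y ∈ {u | (T.deleteEdges {e}).Reachable v u}.toFinset, w y := by
    apply Finset.sum_le_sum_of_subset_of_nonneg
    · intro y hy
      simp only [Finset.mem_insert, Finset.mem_singleton] at hy
      rw [Set.mem_toFinset]
      rcases hy with rfl | rfl
      · exact Reachable.refl _
      · exact hx
    · intro i _ _; exact hw i
  rw [Finset.sum_pair hxv.symm] at h5
  have hk0 : (0 : ℝ) < k := by positivity
  have h6 : 2 / (3 * (k : ℝ)) = 2 / 3 * (1 / k) := by field_simp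
  rw [h6] at hε'
  linarith
end
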